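/- Let k ≥ 1 be an integer, so κ = 1/k and α = k. Put β = k·k!·ζ(k+1) and δ = 1/2 + (1/2 + k/(k+1))/(k+1). Then there exists a sequence of real numbers λ(0), λ(1), …, λ(k) with λ(0) = (1 + 1/k)·β and λ(1) = k!·ζ(k)/2 if k > 1 (and λ(1) = 0 if k = 1), such that p_{1/k}(n) ~ (e^{A}/√(2πβ(k+1))) · (β/n)^{δ} · exp( Σ_{h=0}^{k} λ(h)·(n/β)^{(k−h)/(k+1)} ) as n → ∞, where A = Σ_{h=0}^{k−1} binom(k,h)·ζ'(−h). -/

import Mathlib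

open Filter Topology Real
open scoped Classical

/-- The Piatetski-Shapiro part: `⌊ℓ^κ⌋`. -/
noncomputable def psPart (κ : ℝ) (ℓ : ℕ) : ℕ := ⌊(ℓ : ℝ) ^ κ⌋₊

/-- `p_κ(n)`: number of partitions of `n` into parts from `(⌊ℓ^κ⌋)_{ℓ ≥ 1}`. -/
noncomputable def pk (κ : ℝ) (n : ℕ) : ℕ :=
  Nat.card {r : ℕ →₀ ℕ // (r.sum fun ℓ j => j * psPart κ (ℓ + 1)) = n}

/-- Riemann zeta at a real argument (real-valued there). -/
noncomputable def realZeta (x : ℝ) : ℝ := (riemannZeta (x : ℂ)).re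

/-- Derivative of the Riemann zeta function at a real argument (real-valued there). -/
noncomputable def realZetaDeriv (x : ℝ) : ℝ := (deriv riemannZeta (x : ℂ)).re

/-- The exponential sum `∑_{m ≥ 1} m ^ q * exp (-m x)`. -/
noncomputable def powExpSum (q : ℕ) (x : ℝ) : ℝ :=
  ∑' m : ℕ, ((m : ℝ) + 1) ^ q * Real.exp (-(((m : ℝ) + 1) * x))

lemma summable_powExpSum (q : ℕ) {x : ℝ} (hx : 0 < x) :
    Summable fun m : ℕ => ((m : ℝ) + 1) ^ q * Real.exp (-(((m : ℝ) + 1) * x)) := by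
  have h := (summable_nat_add_iff 1).2 (Real.summable_pow_mul_exp_neg_nat_mul q hx)
  refine h.congr fun m => ?_
  push_cast
  ring_nf

lemma powExpSum_nonneg (q : ℕ) (x : ℝ) : 0 ≤ powExpSum q x :=
  tsum_nonneg fun m => by positivity

lemma powExpSum_anti (q : ℕ) {x y : ℝ} (hx : 0 < x) (hxy : x ≤ y) :
    powExpSum q y ≤ powExpSum q x := by
  refine (summable_powExpSum q (hx.trans_le hxy)).tsum_le_tsum (fun m => ?_)
    (summable_powExpSum q hx)
  gcongr

lemma powExpSum_le_exp (q : ℕ) {x : ℝ} (hx : 0 < x) :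
    powExpSum q x ≤ Real.exp (-(x / 2)) * powExpSum q (x / 2) := by
  rw [powExpSum, powExpSum, ← tsum_mul_left]
  refine (summable_powExpSum q hx).tsum_le_tsum (fun m => ?_)
    ((summable_powExpSum q (half_pos hx)).mul_left _)
  rw [mul_left_comm, ← Real.exp_add]
  gcongr
  nlinarith [mul_nonneg (Nat.cast_nonneg (α := ℝ) m) hx.le]

lemma hasDerivAt_powExpSum (q : ℕ) {x : ℝ} (hx : 0 < x) :
    HasDerivAt (powExpSum q) (-powExpSum (q + 1) x) x := by
  have hx2 : x / 2 < x := by linarith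
  have key := hasDerivAt_tsum_of_isPreconnected (𝕜 := ℝ) (t := Set.Ioi (x / 2)) (y₀ := x) (y := x)
    (g := fun (m : ℕ) (y : ℝ) => ((m : ℝ) + 1) ^ q * Real.exp (-(((m : ℝ) + 1) * y)))
    (g' := fun (m : ℕ) (y : ℝ) => -(((m : ℝ) + 1) ^ (q + 1) * Real.exp (-(((m : ℝ) + 1) * y))))
    (summable_powExpSum (q + 1) (half_pos hx)) isOpen_Ioi isPreconnected_Ioi
    (fun m y _ => by
      have h1 : HasDerivAt (fun y : ℝ => -(((m : ℝ) + 1) * y)) (-((m : ℝ) + 1)) y := by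
        simpa using ((hasDerivAt_id y).const_mul ((m : ℝ) + 1)).fun_neg
      exact (h1.exp.const_mul (((m : ℝ) + 1) ^ q)).congr_deriv (by ring))
    (fun m y hy => by
      rw [norm_neg, Real.norm_of_nonneg (by positivity)]
      have : x / 2 ≤ y := le_of_lt hy
      gcongr)
    hx2 (summable_powExpSum q hx) hx2
  rw [tsum_neg] at key
  exact key

lemma powExpSum_zero {x : ℝ} (hx : 0 < x) : powExpSum 0 x = (Real.exp x - 1)⁻¹ := by
  have h1 : Real.exp (-x) < 1 := by simpa using hx
  have h2 : ∀ m : ℕ, ((m : ℝ) + 1) ^ 0 * Real.exp (-(((m : ℝ) + 1) * x)) =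
      Real.exp (-x) * Real.exp (-x) ^ m := fun m => by
    rw [← Real.exp_nat_mul, ← Real.exp_add]; ring_nf
  rw [powExpSum, tsum_congr h2, tsum_mul_left, tsum_geometric_of_lt_one (Real.exp_pos _).le h1,
    Real.exp_neg]
  have h3 := Real.exp_pos x
  have h4 : Real.exp x - 1 ≠ 0 := by
    have := Real.one_lt_exp_iff.2 hx
    linarith
  field_simp

lemma AnalyticAt.dslope_self {f : ℝ → ℝ} {x : ℝ} (hf : AnalyticAt ℝ f x) :
    AnalyticAt ℝ (dslope f x) x := by
  obtain ⟨p, hp⟩ := hf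
  exact hp.has_fpower_series_dslope_fslope.analyticAt

lemma exists_analyticAt_inv_exp_sub_one : ∃ r : ℝ → ℝ, AnalyticAt ℝ r 0 ∧
    ∀ᶠ x in 𝓝[>] (0 : ℝ), (Real.exp x - 1)⁻¹ = 1 / x + r x := by
  set e : ℝ → ℝ := dslope Real.exp 0 with he
  have hea : AnalyticAt ℝ e 0 := AnalyticAt.dslope_self (by fun_prop)
  have he0 : e 0 = 1 := by simp [he]
  have hinv : AnalyticAt ℝ (fun x => (e x)⁻¹) 0 := hea.fun_inv (by simp [he0])
  refine ⟨dslope (fun x => (e x)⁻¹) 0, AnalyticAt.dslope_self hinv, ?_⟩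
  have hne : ∀ᶠ x in 𝓝[>] (0 : ℝ), e x ≠ 0 :=
    (hea.continuousAt.eventually_ne (by simp [he0])).filter_mono nhdsWithin_le_nhds
  filter_upwards [hne, self_mem_nhdsWithin] with x hx hx0
  have hx0 : x ≠ 0 := ne_of_gt hx0
  have h1 := sub_smul_dslope Real.exp 0 x
  have h2 := sub_smul_dslope (fun x => (e x)⁻¹) 0 x
  simp only [sub_zero, smul_eq_mul, he0, inv_one, Real.exp_zero] at h1 h2
  rw [← h1, ← mul_right_inj' hx0, mul_add, h2]
  rw [← he]
  field_simp
  ring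

lemma exists_analyticAt_powExpSum (q : ℕ) : ∃ r : ℝ → ℝ, AnalyticAt ℝ r 0 ∧
    ∀ᶠ x in 𝓝[>] (0 : ℝ), powExpSum q x = (q.factorial : ℝ) / x ^ (q + 1) + r x := by
  induction q with
  | zero =>
    obtain ⟨r, hr, h⟩ := exists_analyticAt_inv_exp_sub_one
    refine ⟨r, hr, ?_⟩
    filter_upwards [h, self_mem_nhdsWithin] with x hx hx0
    rw [powExpSum_zero hx0, hx]
    simp
  | succ q ih =>
    obtain ⟨r, hr, h⟩ := ih
    refine ⟨fun x => -deriv r x, hr.deriv.neg, ?_⟩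
    have hd : ∀ᶠ x in 𝓝[>] (0 : ℝ), AnalyticAt ℝ r x :=
      hr.eventually_analyticAt.filter_mono nhdsWithin_le_nhds
    filter_upwards [eventually_eventually_nhdsWithin.2 h, hd, self_mem_nhdsWithin] with x hx hrx hx0
    rw [nhdsWithin_eq_nhds.2 (Ioi_mem_nhds hx0)] at hx
    have hx0' : x ≠ 0 := ne_of_gt hx0
    have h1 : HasDerivAt (fun x : ℝ => (q.factorial : ℝ) / x ^ (q + 1) + r x)
        (-(((q + 1).factorial : ℝ) / x ^ (q + 1 + 1)) + deriv r x) x := by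
      have h2 := ((hasDerivAt_pow (q + 1) x).fun_inv (pow_ne_zero _ hx0')).const_mul
        (q.factorial : ℝ)
      refine (HasDerivAt.fun_add ?_ hrx.differentiableAt.hasDerivAt)
      refine (h2.congr_deriv ?_).congr_of_eventuallyEq (Eventually.of_forall fun y => ?_)
      · rw [Nat.factorial_succ]
        push_cast
        field_simp
        ring
      · simp [div_eq_mul_inv]
    have h3 := (hasDerivAt_powExpSum q hx0).unique (h1.congr_of_eventuallyEq hx)
    linarith

/-- The difference between `powExpSum` and its polar part at `0`. -/
noncomputable def powExpRem (q : ℕ) (x : ℝ) : ℝ :=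
  powExpSum q x - (q.factorial : ℝ) / x ^ (q + 1)

lemma abs_powExpRem_le (q : ℕ) : ∃ C : ℝ, 0 < C ∧ ∀ x : ℝ, 0 < x →
    |powExpRem q x| ≤ C ∧ |powExpRem q x| ≤ C * (1 / x ^ (q + 1)) := by
  obtain ⟨r, hr, h⟩ := exists_analyticAt_powExpSum q
  obtain ⟨B, hB⟩ := hr.continuousAt.norm.isBoundedUnder_le
  have hB' := (eventually_map.1 hB).filter_mono (nhdsWithin_le_nhds (s := Set.Ioi 0))
  obtain ⟨ε, hε, hεB⟩ := mem_nhdsGT_iff_exists_Ioc_subset.1 (h.and hB')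
  have hε : 0 < ε := hε
  set K : ℝ := powExpSum q (ε / 2) * ((q + 1).factorial * 2 ^ (q + 1)) with hK
  have hK0 : 0 ≤ K := by have := powExpSum_nonneg q (ε / 2); positivity
  refine ⟨|B| + |B| * ε ^ (q + 1) + (powExpSum q ε + q.factorial / ε ^ (q + 1)) +
    (K + q.factorial) + 1, ?_, fun x hx => ?_⟩
  · have := powExpSum_nonneg q ε
    positivity
  have hgε := powExpSum_nonneg q ε
  have hp1 : 0 ≤ |B| * ε ^ (q + 1) := by positivity
  have hp2 : 0 ≤ (q.factorial : ℝ) / ε ^ (q + 1) := by positivity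
  have hp3 : (0 : ℝ) ≤ q.factorial := by positivity
  rcases le_or_gt x ε with hxε | hxε
  · obtain ⟨h1, h2⟩ := hεB ⟨hx, hxε⟩
    have h3 : |powExpRem q x| ≤ |B| := by
      rw [powExpRem, h1, add_sub_cancel_left]
      exact (show |r x| ≤ B from h2).trans (le_abs_self B)
    refine ⟨by linarith [abs_nonneg B], ?_⟩
    rw [mul_one_div, le_div_iff₀ (by positivity)]
    have : |powExpRem q x| * x ^ (q + 1) ≤ |B| * ε ^ (q + 1) := by gcongr
    linarith [abs_nonneg B]
  · have h1 : |powExpRem q x| ≤ powExpSum q x + q.factorial / x ^ (q + 1) := by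
      rw [powExpRem]
      refine (abs_sub _ _).trans ?_
      rw [abs_of_nonneg (powExpSum_nonneg q x), abs_of_nonneg (by positivity)]
    have h2 : powExpSum q x ≤ powExpSum q ε := powExpSum_anti q hε hxε.le
    have h3 : (q.factorial : ℝ) / x ^ (q + 1) ≤ q.factorial / ε ^ (q + 1) := by gcongr
    have h4 : powExpSum q x ≤ K / x ^ (q + 1) := by
      have e1 : Real.exp (-(x / 2)) ≤ ((q + 1).factorial * 2 ^ (q + 1)) / x ^ (q + 1) := by
        have := Real.pow_div_factorial_le_exp (x / 2) (by positivity) (q + 1)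
        rw [Real.exp_neg, inv_le_comm₀ (Real.exp_pos _) (by positivity)]
        refine le_trans (le_of_eq ?_) this
        rw [div_pow]
        field_simp
      calc powExpSum q x ≤ Real.exp (-(x / 2)) * powExpSum q (x / 2) := powExpSum_le_exp q hx
        _ ≤ (((q + 1).factorial * 2 ^ (q + 1)) / x ^ (q + 1)) * powExpSum q (ε / 2) := by
          have := powExpSum_nonneg q (x / 2)
          have := powExpSum_anti q (half_pos hε) (by linarith : ε / 2 ≤ x / 2)
          gcongr
        _ = K / x ^ (q + 1) := by rw [hK]; ring
    refine ⟨by linarith [abs_nonneg B], ?_⟩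
    have h5 : |powExpRem q x| ≤ (K + q.factorial) * (1 / x ^ (q + 1)) := by
      rw [mul_one_div, add_div]
      linarith
    refine h5.trans (mul_le_mul_of_nonneg_right ?_ (by positivity))
    linarith [abs_nonneg B]

lemma isBigO_powExpSum_atTop (q : ℕ) :
    (fun x : ℝ => (powExpSum q x : ℂ)) =O[atTop] fun x => Real.exp (-(1 / 2) * x) := by
  refine Asymptotics.IsBigO.of_bound (powExpSum q (1 / 2)) ?_
  filter_upwards [eventually_ge_atTop 1] with x hx
  rw [Complex.norm_real, Real.norm_of_nonneg (powExpSum_nonneg q x),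
    Real.norm_of_nonneg (Real.exp_pos _).le, mul_comm]
  have h1 := powExpSum_anti q (by norm_num : (0 : ℝ) < 1 / 2) (by linarith : 1 / 2 ≤ x / 2)
  calc powExpSum q x ≤ Real.exp (-(x / 2)) * powExpSum q (x / 2) :=
        powExpSum_le_exp q (by linarith)
    _ ≤ Real.exp (-(1 / 2) * x) * powExpSum q (1 / 2) := by
        rw [show -(1 / 2) * x = -(x / 2) by ring]
        gcongr

lemma isBigO_powExpSum_zero (q : ℕ) :
    (fun x : ℝ => (powExpSum q x : ℂ)) =O[𝓝[>] 0] (· ^ (-((q : ℝ) + 1))) := by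
  obtain ⟨C, hC, h⟩ := abs_powExpRem_le q
  refine Asymptotics.IsBigO.of_bound (C + q.factorial) ?_
  filter_upwards [self_mem_nhdsWithin] with x hx
  have hx : 0 < x := hx
  have e1 : x ^ (-((q : ℝ) + 1)) = 1 / x ^ (q + 1) := by
    rw [Real.rpow_neg hx.le, one_div]
    norm_cast
  rw [Complex.norm_real, e1, Real.norm_of_nonneg (powExpSum_nonneg q x),
    Real.norm_of_nonneg (by positivity)]
  have h1 := (le_abs_self _).trans (h x hx).2
  rw [powExpRem, div_eq_mul_one_div (q.factorial : ℝ)] at h1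
  linarith

lemma continuousOn_powExpSum (q : ℕ) : ContinuousOn (powExpSum q) (Set.Ioi 0) := fun _ hx =>
  (hasDerivAt_powExpSum q hx).continuousAt.continuousWithinAt

lemma locallyIntegrableOn_powExpSum (q : ℕ) :
    MeasureTheory.LocallyIntegrableOn (fun x : ℝ => (powExpSum q x : ℂ)) (Set.Ioi 0) :=
  (Complex.continuous_ofReal.comp_continuousOn (continuousOn_powExpSum q)).locallyIntegrableOn
    measurableSet_Ioi

lemma hasMellin_powExpSum (q : ℕ) {s : ℂ} (hs : (q : ℝ) + 1 < s.re) :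
    HasMellin (fun x : ℝ => (powExpSum q x : ℂ)) s
      (Complex.Gamma s * riemannZeta (s - q)) := by
  refine ⟨mellinConvergent_of_isBigO_rpow_exp (a := 1 / 2) (by norm_num)
    (locallyIntegrableOn_powExpSum q) (isBigO_powExpSum_atTop q) (isBigO_powExpSum_zero q) hs, ?_⟩
  have hs0 : 0 < s.re := by have : (0 : ℝ) ≤ q := Nat.cast_nonneg q; linarith
  have hsum : Summable fun m : ℕ => ‖((m : ℂ) + 1) ^ q‖ / ((m : ℝ) + 1) ^ s.re := by
    have h1 : Summable fun n : ℕ => 1 / ((n : ℝ)) ^ (s.re - q) :=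
      Real.summable_one_div_nat_rpow.2 (by linarith)
    refine ((summable_nat_add_iff 1).2 h1).congr fun m => ?_
    have hm : (0 : ℝ) < (m : ℝ) + 1 := by positivity
    have h2 : ‖((m : ℂ) + 1)‖ = (m : ℝ) + 1 := by exact_mod_cast Complex.norm_natCast (m + 1)
    rw [norm_pow, h2]
    push_cast
    rw [Real.rpow_sub hm, Real.rpow_natCast, one_div_div]
  have key := hasSum_mellin (a := fun m : ℕ => ((m : ℂ) + 1) ^ q) (p := fun m : ℕ => (m : ℝ) + 1)
    (F := fun x : ℝ => (powExpSum q x : ℂ)) (s := s) (fun m => Or.inr (by positivity)) hs0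
    (fun t ht => by
      have := Complex.hasSum_ofReal.2 (summable_powExpSum q ht).hasSum
      rw [← powExpSum] at this
      refine this.congr_fun fun m => ?_
      push_cast
      ring_nf) hsum
  rw [← key.tsum_eq, zeta_eq_tsum_one_div_nat_add_one_cpow (by simp; linarith), ← tsum_mul_left]
  refine tsum_congr fun m => ?_
  have hm : (m : ℂ) + 1 ≠ 0 := by exact_mod_cast Nat.succ_ne_zero m
  push_cast
  rw [Complex.cpow_sub _ _ hm, Complex.cpow_natCast, one_div_div, mul_div_assoc]

lemma isBigO_exp_neg_zero :
    (fun x : ℝ => (Real.exp (-x) : ℂ)) =O[𝓝[>] 0] fun x : ℝ => x ^ (-(0 : ℝ)) := by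
  simp only [neg_zero, Real.rpow_zero]
  refine Asymptotics.IsBigO.of_bound 1 ?_
  filter_upwards [self_mem_nhdsWithin] with x hx
  have hx : 0 < x := hx
  rw [Complex.norm_real, Real.norm_of_nonneg (Real.exp_pos _).le]
  simpa using hx.le

lemma locallyIntegrableOn_exp_neg :
    MeasureTheory.LocallyIntegrableOn (fun x : ℝ => (Real.exp (-x) : ℂ)) (Set.Ioi 0) :=
  (show Continuous fun x : ℝ => (Real.exp (-x) : ℂ) by fun_prop).continuousOn.locallyIntegrableOn
    measurableSet_Ioi

lemma hasMellin_exp_neg {s : ℂ} (hs : 0 < s.re) :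
    HasMellin (fun x : ℝ => (Real.exp (-x) : ℂ)) s (Complex.Gamma s) := by
  refine ⟨mellinConvergent_of_isBigO_rpow_exp (a := 1) one_pos locallyIntegrableOn_exp_neg
    ?_ isBigO_exp_neg_zero hs, ?_⟩
  · refine Asymptotics.IsBigO.of_bound 1 (Eventually.of_forall fun x => ?_)
    simp [Complex.norm_exp]
  · have key := hasSum_mellin (ι := Unit) (a := fun _ => 1) (p := fun _ => 1)
      (F := fun x : ℝ => (Real.exp (-x) : ℂ)) (s := s) (fun _ => Or.inr one_pos) hs
      (fun t _ => by simp)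
      (Summable.of_finite)
    rw [← key.tsum_eq]
    simp

/-- The entire function `(s - 1) * ζ(s)`. -/
noncomputable def zetaMulSub : ℂ → ℂ :=
  Function.update (fun s => (s - 1) * riemannZeta s) 1 1

lemma zetaMulSub_of_ne {s : ℂ} (hs : s ≠ 1) : zetaMulSub s = (s - 1) * riemannZeta s := by
  simp [zetaMulSub, hs]

lemma differentiable_zetaMulSub : Differentiable ℂ zetaMulSub := by
  have h1 : ∀ s : ℂ, s ≠ 1 → DifferentiableAt ℂ zetaMulSub s := fun s hs => by
    have h2 : DifferentiableAt ℂ (fun s => (s - 1) * riemannZeta s) s :=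
      (differentiableAt_id.sub_const 1).mul (differentiableAt_riemannZeta hs)
    refine h2.congr_of_eventuallyEq ?_
    filter_upwards [isOpen_ne.mem_nhds hs] with z hz using zetaMulSub_of_ne hz
  intro s
  rcases eq_or_ne s 1 with rfl | hs
  · refine (Complex.analyticAt_of_differentiable_on_punctured_nhds_of_continuousAt ?_
      ?_).differentiableAt
    · filter_upwards [self_mem_nhdsWithin] with z hz using h1 z hz
    · exact continuousAt_update_same.2 riemannZeta_residue_one
  · exact h1 s hs

lemma exists_riemannZeta_neg_eq_and_integral (q : ℕ) :
    riemannZeta (-(q : ℂ)) = (realZeta (-(q : ℝ)) : ℂ) ∧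
    (∃ C : ℝ, 0 < C ∧ ∀ x : ℝ, 0 < x →
      |(powExpRem q x - realZeta (-(q : ℝ)) * Real.exp (-x)) / x| ≤ C ∧
      |(powExpRem q x - realZeta (-(q : ℝ)) * Real.exp (-x)) / x| ≤ C * (1 / x ^ 2)) ∧
    ∫ x in Set.Ioi (0 : ℝ), (powExpRem q x - realZeta (-(q : ℝ)) * Real.exp (-x)) / x =
      realZetaDeriv (-(q : ℝ)) := by
  obtain ⟨r, hr, hreq⟩ := exists_analyticAt_powExpSum q
  set c : ℝ := r 0 with hc
  have hq0 : (0 : ℝ) ≤ q := Nat.cast_nonneg q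
  set φ : ℝ → ℝ := fun x => powExpRem q x - c * Real.exp (-x) with hφ
  have hφO : φ =O[𝓝[>] 0] fun x => x := by
    have h1 : DifferentiableAt ℝ (fun x => r x - c * Real.exp (-x)) 0 :=
      hr.differentiableAt.sub (by fun_prop)
    have h2 := h1.isBigO_sub
    simp only [neg_zero, Real.exp_zero, mul_one, ← hc, sub_self, sub_zero] at h2
    refine (h2.mono nhdsWithin_le_nhds).congr' ?_ EventuallyEq.rfl
    filter_upwards [hreq] with x hx
    simp [hφ, powExpRem, hx]
  set f : ℝ → ℂ := fun x => (powExpSum q x : ℂ) -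
    (q.factorial : ℂ) • Set.indicator (Set.Ioc 0 1) (fun t : ℝ => (t : ℂ) ^ (-((q : ℂ) + 1))) x -
    (c : ℂ) • (Real.exp (-x) : ℂ) with hf
  have hpow : ∀ x : ℝ, 0 < x → (x : ℂ) ^ (-((q : ℂ) + 1)) = ((1 / x ^ (q + 1) : ℝ) : ℂ) := by
    intro x hx
    rw [Complex.cpow_neg]
    push_cast
    rw [one_div]
    norm_cast
  have hf0 : ∀ x ∈ Set.Ioc (0 : ℝ) 1, f x = (φ x : ℂ) := fun x hx => by
    simp only [hf, hφ, Set.indicator_of_mem hx, hpow x hx.1, powExpRem, smul_eq_mul]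
    push_cast
    ring
  have hf1 : ∀ x : ℝ, 1 < x → f x = (powExpSum q x : ℂ) - (c : ℂ) • (Real.exp (-x) : ℂ) :=
    fun x hx => by
      have : x ∉ Set.Ioc (0 : ℝ) 1 := fun h => absurd h.2 (not_le.2 hx)
      simp [hf, Set.indicator_of_notMem this]
  have hfbot : f =O[𝓝[>] 0] fun x => x ^ (-(-1 : ℝ)) := by
    have h1 : (fun x => (φ x : ℂ)) =O[𝓝[>] 0] fun x : ℝ => x ^ (-(-1 : ℝ)) := by
      simpa [Asymptotics.isBigO_iff] using Asymptotics.isBigO_iff.1 hφO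
    refine h1.congr' ?_ EventuallyEq.rfl
    filter_upwards [Ioc_mem_nhdsGT (zero_lt_one (α := ℝ))] with x hx using (hf0 x hx).symm
  have hftop : f =O[atTop] fun x => Real.exp (-(1 / 2) * x) := by
    have h1 : (fun x : ℝ => (c : ℂ) • (Real.exp (-x) : ℂ)) =O[atTop]
        fun x => Real.exp (-(1 / 2) * x) := by
      refine Asymptotics.IsBigO.of_bound |c| ?_
      filter_upwards [eventually_ge_atTop 0] with x hx
      rw [norm_smul, Complex.norm_real, Complex.norm_real, Real.norm_eq_abs,
        Real.norm_of_nonneg (Real.exp_pos _).le, Real.norm_of_nonneg (Real.exp_pos _).le]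
      gcongr
      linarith
    refine ((isBigO_powExpSum_atTop q).sub h1).congr' ?_ EventuallyEq.rfl
    filter_upwards [eventually_gt_atTop 1] with x hx using (hf1 x hx).symm
  have hcpow : ContinuousOn (fun t : ℝ => (t : ℂ) ^ (-((q : ℂ) + 1))) (Set.Ioi 0) := fun t ht =>
    (Complex.continuousAt_ofReal_cpow_const _ _ (Or.inr (ne_of_gt ht))).continuousWithinAt
  have hfloc : MeasureTheory.LocallyIntegrableOn f (Set.Ioi 0) := by
    refine MeasureTheory.LocallyIntegrableOn.sub (MeasureTheory.LocallyIntegrableOn.sub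
      (locallyIntegrableOn_powExpSum q) ?_) ?_
    · intro x hx
      obtain ⟨U, hU, hUi⟩ := hcpow.locallyIntegrableOn (μ := MeasureTheory.volume)
        measurableSet_Ioi x hx
      exact ⟨U, hU, (MeasureTheory.Integrable.indicator hUi measurableSet_Ioc).const_mul _⟩
    · intro x hx
      obtain ⟨U, hU, hUi⟩ := locallyIntegrableOn_exp_neg x hx
      exact ⟨U, hU, MeasureTheory.Integrable.const_mul hUi _⟩
  have hdiff : ∀ s : ℂ, -1 < s.re → DifferentiableAt ℂ (mellin f) s := fun s hs =>
    mellin_differentiableAt_of_isBigO_rpow_exp (a := 1 / 2) (by norm_num) hfloc hftop hfbot hs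
  have hmel : ∀ s : ℂ, (q : ℝ) + 1 < s.re → mellin f s =
      Complex.Gamma s * riemannZeta (s - q) - q.factorial * (1 / (s + -((q : ℂ) + 1))) -
        c * Complex.Gamma s := by
    intro s hs
    have h1 := hasMellin_powExpSum q hs
    have h2 := hasMellin_cpow_Ioc (-((q : ℂ) + 1)) (s := s) (by simp; linarith)
    have h2' := hasMellin_const_smul h2.1 (q.factorial : ℂ)
    have h3 := hasMellin_exp_neg (s := s) (by linarith)
    have h3' := hasMellin_const_smul h3.1 (c : ℂ)
    have h4 := hasMellin_sub h1.1 h2'.1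
    have h5 := hasMellin_sub h4.1 h3'.1
    rw [h4.2, h2'.2, h3'.2, h1.2, h2.2, h3.2] at h5
    simpa [hf] using h5.2
  set U : Set ℂ := {s : ℂ | -1 < s.re} with hU
  have hUo : IsOpen U := isOpen_lt continuous_const Complex.continuous_re
  have hUc : IsPreconnected U := (convex_halfSpace_re_gt (-1)).isPreconnected
  set L : ℂ → ℂ := fun s => s * (s - (q + 1)) * mellin f s + q.factorial * s with hL
  set R : ℂ → ℂ := fun s => Complex.Gamma (s + 1) * (zetaMulSub (s - q) - c * (s - (q + 1)))
    with hR
  have hLd : DifferentiableOn ℂ L U := fun s hs =>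
    DifferentiableAt.differentiableWithinAt
      ((DifferentiableAt.mul (by fun_prop) (hdiff s hs)).add (by fun_prop))
  have hΓd : ∀ s ∈ U, DifferentiableAt ℂ (fun s => Complex.Gamma (s + 1)) s := fun s hs => by
    refine DifferentiableAt.comp s (Complex.differentiableAt_Gamma _ fun m hm => ?_) (by fun_prop)
    have h1 := congrArg Complex.re hm
    have h2 : -1 < s.re := hs
    have h3 : (0 : ℝ) ≤ m := Nat.cast_nonneg m
    simp at h1
    linarith
  have hRd : DifferentiableOn ℂ R U := fun s hs => by
    refine DifferentiableAt.differentiableWithinAt ((hΓd s hs).mul (DifferentiableAt.sub ?_ ?_))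
    · exact (differentiable_zetaMulSub _).comp s (by fun_prop)
    · fun_prop
  have hLR : Set.EqOn L R U := by
    refine (hLd.analyticOnNhd hUo).eqOn_of_preconnected_of_eventuallyEq (hRd.analyticOnNhd hUo)
      hUc (z₀ := (q : ℂ) + 2) ?_ ?_
    · simp [hU]; linarith
    · have h1 : {s : ℂ | (q : ℝ) + 1 < s.re} ∈ 𝓝 ((q : ℂ) + 2) :=
        (isOpen_lt continuous_const Complex.continuous_re).mem_nhds (by simp)
      filter_upwards [h1] with s hs
      have hs : (q : ℝ) + 1 < s.re := hs
      have hs0 : s ≠ 0 := by rintro rfl; simp at hs; linarith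
      have hs1 : s - (q + 1) ≠ 0 := fun h => by
        have := congrArg Complex.re h
        simp at this
        linarith
      have hs2 : s - q ≠ 1 := fun h => hs1 (by rw [← h]; ring)
      simp only [hL, hR]
      rw [hmel s hs, Complex.Gamma_add_one s hs0, zetaMulSub_of_ne hs2,
        show s + -((q : ℂ) + 1) = s - (q + 1) by ring]
      field_simp
      ring
  set M : ℂ → ℂ := fun s => mellin f s + q.factorial / (s - (q + 1)) with hM
  have hq1 : (0 : ℂ) - (q + 1) ≠ 0 := by
    rw [zero_sub, neg_ne_zero]; exact_mod_cast Nat.succ_ne_zero q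
  have hMR : (fun s => s * M s) =ᶠ[𝓝 0] fun s => Complex.Gamma (s + 1) *
      (riemannZeta (s - q) - c) := by
    have h1 : ∀ᶠ s : ℂ in 𝓝 0, s - (q + 1) ≠ 0 :=
      (show ContinuousAt (fun s : ℂ => s - (q + 1)) 0 by fun_prop).eventually_ne hq1
    have h2 : U ∈ 𝓝 (0 : ℂ) := hUo.mem_nhds (by simp [hU])
    filter_upwards [h1, h2] with s hs1 hsU
    have hs2 : s - q ≠ 1 := fun h => hs1 (by rw [← h]; ring)
    have h3 := hLR hsU
    simp only [hL, hR, zetaMulSub_of_ne hs2] at h3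
    rw [← mul_right_inj' hs1]
    simp only [hM]
    field_simp
    linear_combination h3
  have hζc : riemannZeta (-(q : ℂ)) = c := by
    have := hMR.eq_of_nhds
    simp only [zero_mul, zero_add, Complex.Gamma_one, one_mul, zero_sub] at this
    exact (sub_eq_zero.1 this.symm)
  have hcz : c = realZeta (-(q : ℝ)) := by
    rw [realZeta]
    push_cast
    rw [hζc, Complex.ofReal_re]
  have hM0 : M 0 = deriv riemannZeta (-(q : ℂ)) := by
    have hMd : DifferentiableAt ℂ M 0 :=
      (hdiff 0 (by simp)).add (DifferentiableAt.div (by fun_prop) (by fun_prop) hq1)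
    have h1 : HasDerivAt (fun s => s * M s) (M 0) 0 := by
      simpa using (hasDerivAt_id' (0 : ℂ)).fun_mul hMd.hasDerivAt
    have hz : HasDerivAt (fun s : ℂ => riemannZeta (s - q)) (deriv riemannZeta (-(q : ℂ))) 0 := by
      have hne : (0 : ℂ) - q ≠ 1 := fun h => hq1 (by rw [← sub_sub, h, sub_self])
      have := (differentiableAt_riemannZeta hne).hasDerivAt.comp_sub_const (0 : ℂ) (q : ℂ)
      simpa using this
    have h2 := (hΓd 0 (by simp [hU])).hasDerivAt.fun_mul (hz.sub_const (c : ℂ))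
    have h3 := h1.unique (h2.congr_of_eventuallyEq hMR)
    simpa [hζc] using h3
  have hbound : ∃ C : ℝ, 0 < C ∧ ∀ x : ℝ, 0 < x → |φ x / x| ≤ C ∧ |φ x / x| ≤ C * (1 / x ^ 2) := by
    obtain ⟨C₁, hC₁⟩ := hφO.bound
    obtain ⟨ε, hε, hεB⟩ := mem_nhdsGT_iff_exists_Ioc_subset.1 hC₁
    have hε : 0 < ε := hε
    obtain ⟨C₂, hC₂, hR2⟩ := abs_powExpRem_le q
    set K := |C₁| + |C₁| * ε ^ 2 + (C₂ + |c|) * (ε⁻¹) + (C₂ * ε⁻¹ ^ q + |c|) + 1 with hK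
    refine ⟨K, by positivity, fun x hx => ?_⟩
    have p1 : 0 ≤ |C₁| := abs_nonneg _
    have p2 : 0 ≤ |C₁| * ε ^ 2 := by positivity
    have p3 : 0 ≤ (C₂ + |c|) * (ε⁻¹) := by positivity
    have p4 : 0 ≤ C₂ * ε⁻¹ ^ q + |c| := by positivity
    rcases le_or_gt x ε with hxε | hxε
    · have h1 : |φ x / x| ≤ |C₁| := by
        have h2 : ‖φ x‖ ≤ C₁ * ‖x‖ := hεB ⟨hx, hxε⟩
        rw [Real.norm_eq_abs, Real.norm_eq_abs] at h2
        rw [abs_div, div_le_iff₀ (abs_pos.2 hx.ne')]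
        exact h2.trans (mul_le_mul_of_nonneg_right (le_abs_self _) (abs_nonneg _))
      refine ⟨by linarith, ?_⟩
      rw [mul_one_div, le_div_iff₀ (by positivity)]
      have : |φ x / x| * x ^ 2 ≤ |C₁| * ε ^ 2 := by gcongr
      linarith
    · have h1 : |φ x| ≤ |powExpRem q x| + |c| * Real.exp (-x) := by
        simp only [hφ]
        refine (abs_sub _ _).trans ?_
        rw [abs_mul, abs_of_pos (Real.exp_pos _)]
      have h2 : Real.exp (-x) ≤ 1 := by simpa using hx.le
      have h2' : Real.exp (-x) ≤ 1 / x := by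
        rw [Real.exp_neg, one_div]
        gcongr
        linarith [Real.add_one_le_exp x]
      have h3 : x⁻¹ ≤ ε⁻¹ := by gcongr
      rw [abs_div, abs_of_pos hx, div_eq_mul_inv]
      constructor
      · have h4 : |φ x| ≤ C₂ + |c| := by
          have := (hR2 x hx).1
          have := mul_le_mul_of_nonneg_left h2 (abs_nonneg c)
          linarith
        have : |φ x| * x⁻¹ ≤ (C₂ + |c|) * ε⁻¹ := by gcongr
        linarith
      · have h4 : |φ x| ≤ (C₂ * ε⁻¹ ^ q + |c|) * (1 / x) := by
          have h5 := (hR2 x hx).2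
          have h6 := mul_le_mul_of_nonneg_left h2' (abs_nonneg c)
          have h7 : C₂ * (1 / x ^ (q + 1)) ≤ C₂ * ε⁻¹ ^ q * (1 / x) := by
            rw [mul_assoc]
            refine mul_le_mul_of_nonneg_left ?_ hC₂.le
            rw [one_div, ← inv_pow, pow_succ, one_div]
            gcongr
          linarith
        calc |φ x| * x⁻¹ ≤ ((C₂ * ε⁻¹ ^ q + |c|) * (1 / x)) * x⁻¹ := by gcongr
          _ = (C₂ * ε⁻¹ ^ q + |c|) * (1 / x ^ 2) := by field_simp
          _ ≤ K * (1 / x ^ 2) := by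
            refine mul_le_mul_of_nonneg_right ?_ (by positivity)
            linarith
  rw [← hcz]
  refine ⟨hζc, hbound, ?_⟩
  have hconv : MellinConvergent f 0 :=
    mellinConvergent_of_isBigO_rpow_exp (a := 1 / 2) (by norm_num) hfloc hftop hfbot (by simp)
  set J : ℝ → ℂ := Set.indicator (Set.Ioi 1)
    (fun x : ℝ => (q.factorial : ℂ) * (x : ℂ) ^ (-((q : ℂ) + 2))) with hJ
  have hre : (-((q : ℂ) + 2)).re < -1 := by simp; linarith
  have hJi : MeasureTheory.IntegrableOn J (Set.Ioi 0) := by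
    rw [hJ]
    refine MeasureTheory.Integrable.integrableOn ?_
    rw [MeasureTheory.integrable_indicator_iff measurableSet_Ioi]
    exact (integrableOn_Ioi_cpow_of_lt hre one_pos).const_mul _
  have hJv : ∫ x in Set.Ioi (0 : ℝ), J x = q.factorial / (q + 1) := by
    rw [hJ, MeasureTheory.setIntegral_indicator measurableSet_Ioi,
      Set.inter_eq_self_of_subset_right (Set.Ioi_subset_Ioi zero_le_one),
      MeasureTheory.integral_const_mul, integral_Ioi_cpow_of_lt hre one_pos]
    have : -((q : ℂ) + 2) + 1 = -(q + 1) := by ring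
    rw [this, Complex.ofReal_one, Complex.one_cpow, neg_div_neg_eq, mul_one_div]
  have hkey : ∀ x ∈ Set.Ioi (0 : ℝ), ((φ x / x : ℝ) : ℂ) = (x : ℂ) ^ ((0 : ℂ) - 1) • f x - J x := by
    intro x hx
    have hx : 0 < x := hx
    have hxc : (x : ℂ) ≠ 0 := by exact_mod_cast hx.ne'
    have e1 : (x : ℂ) ^ ((0 : ℂ) - 1) = (x : ℂ)⁻¹ := by
      rw [zero_sub, Complex.cpow_neg_one]
    rw [e1]
    rcases le_or_gt x 1 with h1 | h1
    · have : x ∉ Set.Ioi (1 : ℝ) := not_lt.2 h1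
      rw [hf0 x ⟨hx, h1⟩, hJ, Set.indicator_of_notMem this]
      push_cast
      rw [smul_eq_mul, sub_zero, div_eq_inv_mul]
    · rw [hf1 x h1, hJ, Set.indicator_of_mem (show x ∈ Set.Ioi (1 : ℝ) from h1)]
      have e2 : (x : ℂ) ^ (-((q : ℂ) + 2)) = (x : ℂ)⁻¹ * ((1 / x ^ (q + 1) : ℝ) : ℂ) := by
        rw [← hpow x hx, ← Complex.cpow_neg_one, ← Complex.cpow_add _ _ hxc]
        ring_nf
      rw [e2]
      simp only [hφ, powExpRem, smul_eq_mul]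
      push_cast
      field_simp
      ring
  have hint : ((∫ x in Set.Ioi (0 : ℝ), φ x / x : ℝ) : ℂ) = M 0 := by
    rw [← integral_complex_ofReal, MeasureTheory.setIntegral_congr_fun measurableSet_Ioi hkey,
      MeasureTheory.integral_sub hconv hJi, hJv]
    simp only [hM, mellin]
    rw [show (0 : ℂ) - (q + 1) = -(q + 1) by ring, div_neg, sub_eq_add_neg]
  rw [hM0] at hint
  rw [realZetaDeriv]
  push_cast
  rw [← hint, Complex.ofReal_re]

lemma tendsto_riemannSum {φ : ℝ → ℝ} {C : ℝ} (hφ : ContinuousOn φ (Set.Ioi 0))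
    (hb : ∀ x : ℝ, 0 < x → |φ x| ≤ C ∧ |φ x| ≤ C * (1 / x ^ 2)) :
    Tendsto (fun t : ℝ => ∑' j : ℕ, t * φ (((j : ℝ) + 1) * t)) (𝓝[>] 0)
      (𝓝 (∫ x in Set.Ioi (0 : ℝ), φ x)) := by
  have hC : 0 ≤ C := (abs_nonneg _).trans (hb 1 one_pos).1
  have hbd : ∀ x y : ℝ, 0 < x → x ≤ y → |φ y| ≤ 2 * C * (1 + x ^ 2)⁻¹ := by
    intro x y hx hxy
    have h1 := hb y (hx.trans_le hxy)
    have h2 : |φ y| * x ^ 2 ≤ C := by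
      have h3 : C * (1 / y ^ 2) ≤ C * (1 / x ^ 2) := by gcongr
      rw [← le_div_iff₀ (by positivity)]
      calc _ ≤ _ := h1.2
        _ ≤ _ := h3
        _ = _ := by ring
    rw [← div_eq_mul_inv, le_div_iff₀ (by positivity)]
    linarith [h1.1]
  have hint : MeasureTheory.IntegrableOn (fun x : ℝ => 2 * C * (1 + x ^ 2)⁻¹) (Set.Ioi 0) :=
    (integrable_inv_one_add_sq.const_mul _).integrableOn
  set g : ℝ → ℝ → ℝ := fun t x => φ ((⌈x / t⌉₊ : ℝ) * t) with hg
  have hgm : ∀ t, Measurable (g t) := fun t =>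
    (measurable_from_nat (f := fun n : ℕ => φ ((n : ℝ) * t))).comp
      (Nat.measurable_ceil.comp (measurable_id.div_const t))
  have hge : ∀ t x : ℝ, 0 < t → x ≤ (⌈x / t⌉₊ : ℝ) * t := fun t x ht => by
    rw [← div_le_iff₀ ht]; exact Nat.le_ceil _
  have hgb : ∀ t x : ℝ, 0 < t → 0 < x → ‖g t x‖ ≤ 2 * C * (1 + x ^ 2)⁻¹ := fun t x ht hx =>
    hbd x _ hx (hge t x ht)
  have hsum : ∀ t : ℝ, 0 < t →
      ∑' j : ℕ, t * φ (((j : ℝ) + 1) * t) = ∫ x in Set.Ioi (0 : ℝ), g t x := by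
    intro t ht
    set S : ℕ → Set ℝ := fun j => {x | ⌈x / t⌉₊ = j + 1} with hS
    have hSe : ∀ j, S j = Set.Ioc (j * t) ((j + 1) * t) := fun j => by
      ext x
      simp only [hS, Set.mem_ofPred_eq, Set.mem_Ioc]
      rw [Nat.ceil_eq_iff (Nat.succ_ne_zero j), lt_div_iff₀ ht, div_le_iff₀ ht]
      simp
    have hSU : ⋃ j, S j = Set.Ioi 0 := by
      ext x
      simp only [hS, Set.mem_iUnion, Set.mem_ofPred_eq, Set.mem_Ioi]
      constructor
      · rintro ⟨j, hj⟩
        have h1 : 0 < ⌈x / t⌉₊ := by omega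
        rw [Nat.ceil_pos] at h1
        exact (div_pos_iff_of_pos_right ht).1 h1
      · intro hx
        have h1 : 0 < ⌈x / t⌉₊ := Nat.ceil_pos.2 (div_pos hx ht)
        exact ⟨⌈x / t⌉₊ - 1, by omega⟩
    have h1 := MeasureTheory.hasSum_integral_iUnion (μ := MeasureTheory.volume) (f := g t) (s := S)
      (fun j => by rw [hSe]; exact measurableSet_Ioc)
      (fun i j hij => Set.disjoint_left.2 fun x (hx : _ = _) (hx' : _ = _) => hij (by omega))
      (by
        rw [hSU]
        refine MeasureTheory.Integrable.mono' hint (hgm t).aestronglyMeasurable ?_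
        filter_upwards [MeasureTheory.ae_restrict_mem measurableSet_Ioi] with x hx
        exact hgb t x ht hx)
    rw [hSU] at h1
    rw [← h1.tsum_eq]
    refine tsum_congr fun j => ?_
    have h2 : ∫ x in S j, g t x = ∫ x in S j, φ (((j : ℝ) + 1) * t) := by
      refine MeasureTheory.setIntegral_congr_fun (by rw [hSe]; exact measurableSet_Ioc) ?_
      intro x hx
      have hx : ⌈x / t⌉₊ = j + 1 := hx
      simp only [hg, hx]
      push_cast
      rfl
    rw [h2, hSe, MeasureTheory.setIntegral_const, smul_eq_mul, Real.volume_real_Ioc_of_le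
      (by nlinarith)]
    ring
  have hev : (fun t : ℝ => ∫ x in Set.Ioi (0 : ℝ), g t x) =ᶠ[𝓝[>] 0]
      fun t : ℝ => ∑' j : ℕ, t * φ (((j : ℝ) + 1) * t) := by
    filter_upwards [self_mem_nhdsWithin] with t ht using (hsum t ht).symm
  refine Tendsto.congr' hev ?_
  refine MeasureTheory.tendsto_integral_filter_of_dominated_convergence
    (fun x : ℝ => 2 * C * (1 + x ^ 2)⁻¹) (Eventually.of_forall fun t =>
      (hgm t).aestronglyMeasurable) ?_ hint ?_
  · filter_upwards [self_mem_nhdsWithin] with t ht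
    filter_upwards [MeasureTheory.ae_restrict_mem measurableSet_Ioi] with x hx
    exact hgb t x ht hx
  · filter_upwards [MeasureTheory.ae_restrict_mem measurableSet_Ioi] with x hx
    have hx : 0 < x := hx
    refine (hφ.continuousAt (Ioi_mem_nhds hx)).tendsto.comp ?_
    have h1 : Tendsto (fun t : ℝ => x + t) (𝓝[>] 0) (𝓝 x) := by
      have : Tendsto (fun t : ℝ => x + t) (𝓝 0) (𝓝 (x + 0)) := by
        exact (continuous_const.add continuous_id).tendsto 0
      rw [add_zero] at this
      exact this.mono_left nhdsWithin_le_nhds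
    refine tendsto_of_tendsto_of_tendsto_of_le_of_le' tendsto_const_nhds h1 ?_ ?_
    · filter_upwards [self_mem_nhdsWithin] with t ht using hge t x ht
    · filter_upwards [self_mem_nhdsWithin] with t ht
      have ht : 0 < t := ht
      have h2 := (Nat.ceil_lt_add_one (div_pos hx ht).le).le
      calc (⌈x / t⌉₊ : ℝ) * t ≤ (x / t + 1) * t := by gcongr
        _ = x + t := by field_simp

lemma realZeta_natCast {n : ℕ} (hn : 1 < n) :
    HasSum (fun j : ℕ => 1 / ((j : ℝ) + 1) ^ n) (realZeta n) := by
  have hs : Summable fun j : ℕ => 1 / ((j : ℝ) + 1) ^ n := by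
    refine ((summable_nat_add_iff 1).2 (Real.summable_one_div_nat_pow.2 hn)).congr fun j => ?_
    push_cast
    rfl
  have h1 : realZeta n = ∑' j : ℕ, 1 / (j : ℝ) ^ n := by
    rw [realZeta]
    push_cast
    rw [zeta_nat_eq_tsum_of_gt_one hn]
    have : ∑' j : ℕ, 1 / (j : ℂ) ^ n = ((∑' j : ℕ, 1 / (j : ℝ) ^ n : ℝ) : ℂ) := by
      push_cast; rfl
    rw [this, Complex.ofReal_re]
  rw [h1, (Real.summable_one_div_nat_pow.2 hn).tsum_eq_zero_add]
  have h0 : 1 / ((0 : ℕ) : ℝ) ^ n = 0 := by simp [show n ≠ 0 by omega]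
  rw [h0, zero_add]
  push_cast
  exact hs.hasSum

/-- The double series `∑ m^q j^(i-1) e^(-mjt)`, with `p = (j - 1, m - 1)`. -/
noncomputable def divisorExpSum (i q : ℕ) (t : ℝ) : ℝ :=
  ∑' p : ℕ × ℕ, ((p.1 : ℝ) + 1) ^ i / ((p.1 : ℝ) + 1) *
    (((p.2 : ℝ) + 1) ^ q * Real.exp (-(((p.2 : ℝ) + 1) * (((p.1 : ℝ) + 1) * t))))

lemma summable_divisorExpSum_aux (i q : ℕ) {t : ℝ} (ht : 0 < t) :
    (Summable fun p : ℕ × ℕ => ((p.1 : ℝ) + 1) ^ i / ((p.1 : ℝ) + 1) *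
      (((p.2 : ℝ) + 1) ^ q * Real.exp (-(((p.2 : ℝ) + 1) * (((p.1 : ℝ) + 1) * t))))) ∧
    HasSum (fun j : ℕ => ((j : ℝ) + 1) ^ i / ((j : ℝ) + 1) * powExpSum q (((j : ℝ) + 1) * t))
      (divisorExpSum i q t) := by
  have h1 : ∀ j : ℕ, 0 < ((j : ℝ) + 1) * t := fun j => by positivity
  have h2 : Summable fun j : ℕ => ((j : ℝ) + 1) ^ i / ((j : ℝ) + 1) *
      powExpSum q (((j : ℝ) + 1) * t) := by
    refine Summable.of_nonneg_of_le
      (fun j => mul_nonneg (by positivity) (powExpSum_nonneg _ _)) (fun j => ?_)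
      ((summable_powExpSum i (half_pos ht)).mul_left (powExpSum q (t / 2)))
    have h3 := powExpSum_le_exp q (h1 j)
    have h4 : powExpSum q (((j : ℝ) + 1) * t / 2) ≤ powExpSum q (t / 2) := by
      refine powExpSum_anti q (half_pos ht) ?_
      have : 0 ≤ (j : ℝ) * t := by positivity
      linarith
    have h5 : ((j : ℝ) + 1) ^ i / ((j : ℝ) + 1) ≤ ((j : ℝ) + 1) ^ i :=
      div_le_self (by positivity) (by linarith [(Nat.cast_nonneg j : (0 : ℝ) ≤ j)])
    calc ((j : ℝ) + 1) ^ i / ((j : ℝ) + 1) * powExpSum q (((j : ℝ) + 1) * t)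
        ≤ ((j : ℝ) + 1) ^ i * (Real.exp (-(((j : ℝ) + 1) * t / 2)) * powExpSum q (t / 2)) := by
          have h6 : powExpSum q (((j : ℝ) + 1) * t) ≤
              Real.exp (-(((j : ℝ) + 1) * t / 2)) * powExpSum q (t / 2) :=
            h3.trans (mul_le_mul_of_nonneg_left h4 (Real.exp_pos _).le)
          exact mul_le_mul h5 h6 (powExpSum_nonneg _ _) (by positivity)
      _ = powExpSum q (t / 2) *
          (((j : ℝ) + 1) ^ i * Real.exp (-(((j : ℝ) + 1) * (t / 2)))) := by
          rw [mul_div_assoc]; ring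
  have h0 : ∀ j : ℕ, ∑' m : ℕ, ((j : ℝ) + 1) ^ i / ((j : ℝ) + 1) *
      (((m : ℝ) + 1) ^ q * Real.exp (-(((m : ℝ) + 1) * (((j : ℝ) + 1) * t)))) =
      ((j : ℝ) + 1) ^ i / ((j : ℝ) + 1) * powExpSum q (((j : ℝ) + 1) * t) := fun j =>
    tsum_mul_left
  have h00 : 0 ≤ fun p : ℕ × ℕ => ((p.1 : ℝ) + 1) ^ i / ((p.1 : ℝ) + 1) *
      (((p.2 : ℝ) + 1) ^ q * Real.exp (-(((p.2 : ℝ) + 1) * (((p.1 : ℝ) + 1) * t)))) := by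
    intro p
    show (0 : ℝ) ≤ ((p.1 : ℝ) + 1) ^ i / ((p.1 : ℝ) + 1) *
      (((p.2 : ℝ) + 1) ^ q * Real.exp (-(((p.2 : ℝ) + 1) * (((p.1 : ℝ) + 1) * t))))
    positivity
  have h3 : Summable fun p : ℕ × ℕ => ((p.1 : ℝ) + 1) ^ i / ((p.1 : ℝ) + 1) *
      (((p.2 : ℝ) + 1) ^ q * Real.exp (-(((p.2 : ℝ) + 1) * (((p.1 : ℝ) + 1) * t)))) := by
    rw [summable_prod_of_nonneg h00]
    refine ⟨fun j => (summable_powExpSum q (h1 j)).mul_left (((j : ℝ) + 1) ^ i / ((j : ℝ) + 1)), ?_⟩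
    simpa only [h0] using h2
  refine ⟨h3, ?_⟩
  rw [divisorExpSum, h3.tsum_prod]
  simp only [h0]
  exact h2.hasSum

lemma abs_divisorExpSum_sub_le (i h : ℕ) : ∃ C : ℝ, 0 < C ∧ ∀ t : ℝ, 0 < t →
    |divisorExpSum i (h + i) t - ((h + i).factorial : ℝ) * realZeta ((h + 2 : ℕ) : ℝ) /
      t ^ (h + i + 1)| ≤ C * t ^ (-((i : ℝ) + 1 / 4)) := by
  obtain ⟨C, hC, hR⟩ := abs_powExpRem_le (h + i)
  have hi0 : (0 : ℝ) ≤ i := Nat.cast_nonneg i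
  have hR' : ∀ x : ℝ, 0 < x → |powExpRem (h + i) x| ≤ C * x ^ (-((i : ℝ) + 1 / 4)) := by
    intro x hx
    rcases le_or_gt x 1 with h1 | h1
    · refine (hR x hx).1.trans (le_mul_of_one_le_right hC.le ?_)
      exact Real.one_le_rpow_of_pos_of_le_one_of_nonpos hx h1 (by linarith)
    · refine (hR x hx).2.trans (mul_le_mul_of_nonneg_left ?_ hC.le)
      rw [one_div, ← Real.rpow_natCast, ← Real.rpow_neg hx.le]
      refine Real.rpow_le_rpow_of_exponent_le h1.le ?_
      push_cast
      have : (0 : ℝ) ≤ h := Nat.cast_nonneg h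
      linarith
  have hs : Summable fun j : ℕ => ((j : ℝ) + 1) ^ (-(5 / 4) : ℝ) := by
    refine ((summable_nat_add_iff 1).2
      (Real.summable_nat_rpow.2 (show (-(5 / 4) : ℝ) < -1 by norm_num))).congr fun j => ?_
    push_cast
    rfl
  refine ⟨C * ∑' j : ℕ, ((j : ℝ) + 1) ^ (-(5 / 4) : ℝ),
    mul_pos hC (hs.tsum_pos (fun j => by positivity) 0 (by positivity)), fun t ht => ?_⟩
  have h1 := (summable_divisorExpSum_aux i (h + i) ht).2
  have h2 := (realZeta_natCast (n := h + 2) (by omega)).mul_left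
    (((h + i).factorial : ℝ) / t ^ (h + i + 1))
  have h3 := h1.sub h2
  have h4 : ∀ j : ℕ, ‖((j : ℝ) + 1) ^ i / ((j : ℝ) + 1) * powExpSum (h + i) (((j : ℝ) + 1) * t) -
      ((h + i).factorial : ℝ) / t ^ (h + i + 1) * (1 / ((j : ℝ) + 1) ^ (h + 2))‖ ≤
      C * t ^ (-((i : ℝ) + 1 / 4)) * ((j : ℝ) + 1) ^ (-(5 / 4) : ℝ) := by
    intro j
    have hj : 0 < (j : ℝ) + 1 := by positivity
    have e1 : ((j : ℝ) + 1) ^ i / ((j : ℝ) + 1) * powExpSum (h + i) (((j : ℝ) + 1) * t) -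
        ((h + i).factorial : ℝ) / t ^ (h + i + 1) * (1 / ((j : ℝ) + 1) ^ (h + 2)) =
        ((j : ℝ) + 1) ^ i / ((j : ℝ) + 1) * powExpRem (h + i) (((j : ℝ) + 1) * t) := by
      have e2 : ((j : ℝ) + 1) ^ (h + 2) = ((j : ℝ) + 1) ^ h * ((j : ℝ) + 1) ^ 2 := pow_add _ _ _
      rw [powExpRem, mul_pow, e2]
      generalize (h + i).factorial = a
      generalize powExpSum (h + i) (((j : ℝ) + 1) * t) = b
      generalize (j : ℝ) + 1 = c at hj
      field_simp
      ring
    rw [e1, norm_mul, Real.norm_of_nonneg (by positivity), Real.norm_eq_abs]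
    calc ((j : ℝ) + 1) ^ i / ((j : ℝ) + 1) * |powExpRem (h + i) (((j : ℝ) + 1) * t)|
        ≤ ((j : ℝ) + 1) ^ i / ((j : ℝ) + 1) *
          (C * (((j : ℝ) + 1) * t) ^ (-((i : ℝ) + 1 / 4))) := by
          gcongr
          exact hR' _ (by positivity)
      _ = C * t ^ (-((i : ℝ) + 1 / 4)) * ((j : ℝ) + 1) ^ (-(5 / 4) : ℝ) := by
          have e2 : ((j : ℝ) + 1) ^ i / ((j : ℝ) + 1) * ((j : ℝ) + 1) ^ (-((i : ℝ) + 1 / 4)) =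
              ((j : ℝ) + 1) ^ (-(5 / 4) : ℝ) := by
            rw [← Real.rpow_natCast, ← Real.rpow_sub_one hj.ne', ← Real.rpow_add hj]
            congr 1
            ring
          rw [Real.mul_rpow hj.le ht.le, ← e2]
          ring
  have h5 := h3.norm_le_of_bounded (hs.hasSum.mul_left (C * t ^ (-((i : ℝ) + 1 / 4)))) h4
  rw [Real.norm_eq_abs] at h5
  calc _ = _ := by rw [div_mul_eq_mul_div]
    _ ≤ _ := h5
    _ = _ := by ring

lemma tendsto_divisorExpSum_zero (h : ℕ) :
    Tendsto (fun t : ℝ => divisorExpSum 0 h t - ((h.factorial : ℝ) * realZeta ((h + 2 : ℕ) : ℝ) /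
      t ^ (h + 1) - realZeta (-(h : ℝ)) * Real.log t)) (𝓝[>] 0) (𝓝 (realZetaDeriv (-(h : ℝ)))) := by
  obtain ⟨-, ⟨C, hC, hb⟩, hint⟩ := exists_riemannZeta_neg_eq_and_integral h
  set z : ℝ := realZeta (-(h : ℝ)) with hz
  set φ : ℝ → ℝ := fun x => (powExpRem h x - z * Real.exp (-x)) / x with hφ
  have hφc : ContinuousOn φ (Set.Ioi 0) := by
    have h1 : ContinuousOn (powExpRem h) (Set.Ioi 0) :=
      (continuousOn_powExpSum h).sub (continuousOn_const.div (by fun_prop)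
        fun x hx => pow_ne_zero _ (ne_of_gt hx))
    exact (h1.sub (by fun_prop)).div continuousOn_id fun x hx => ne_of_gt hx
  have h1 := tendsto_riemannSum hφc hb
  rw [hint] at h1
  have h2 : Tendsto (fun t : ℝ => z * (-Real.log (1 - Real.exp (-t)) + Real.log t)) (𝓝[>] 0)
      (𝓝 0) := by
    have h3 : Tendsto (fun t : ℝ => t⁻¹ * (1 - Real.exp (-t))) (𝓝[>] 0) (𝓝 1) := by
      have h4 : HasDerivAt (fun t : ℝ => 1 - Real.exp (-t)) 1 0 := by
        simpa using ((hasDerivAt_neg (0 : ℝ)).exp).const_sub 1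
      have h5 := h4.tendsto_slope_zero_right
      simpa using h5
    have h4 := ((Real.continuousAt_log one_ne_zero).tendsto.comp h3).neg.const_mul z
    rw [Real.log_one, neg_zero, mul_zero] at h4
    refine h4.congr' ?_
    filter_upwards [self_mem_nhdsWithin] with t ht
    have ht : 0 < t := ht
    have h5 : 0 < 1 - Real.exp (-t) := by simpa using ht
    simp only [Function.comp]
    rw [Real.log_mul (by positivity) h5.ne', Real.log_inv]
    ring
  have h3 := h1.add h2
  rw [add_zero] at h3
  refine h3.congr' ?_
  filter_upwards [self_mem_nhdsWithin] with t ht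
  have ht : 0 < t := ht
  have g1 := (summable_divisorExpSum_aux 0 h ht).2
  have g2 := (realZeta_natCast (n := h + 2) (by omega)).mul_left ((h.factorial : ℝ) / t ^ (h + 1))
  have g3 : HasSum (fun j : ℕ => Real.exp (-t) ^ (j + 1) / ((j : ℝ) + 1))
      (-Real.log (1 - Real.exp (-t))) := by
    refine Real.hasSum_pow_div_log_of_abs_lt_one ?_
    rw [abs_of_pos (Real.exp_pos _)]
    simpa using ht
  have g4 := (g1.sub g2).sub (g3.mul_left z)
  have g5 : (fun j : ℕ => ((j : ℝ) + 1) ^ 0 / ((j : ℝ) + 1) * powExpSum h (((j : ℝ) + 1) * t) -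
      (h.factorial : ℝ) / t ^ (h + 1) * (1 / ((j : ℝ) + 1) ^ (h + 2)) -
      z * (Real.exp (-t) ^ (j + 1) / ((j : ℝ) + 1))) = fun j : ℕ => t * φ (((j : ℝ) + 1) * t) := by
    funext j
    have hj : 0 < (j : ℝ) + 1 := by positivity
    rw [← Real.exp_nat_mul]
    have e2 : ((j : ℝ) + 1) ^ (h + 2) = ((j : ℝ) + 1) ^ h * ((j : ℝ) + 1) ^ 2 := pow_add _ _ _
    simp only [hφ, powExpRem]
    push_cast
    rw [mul_neg, mul_pow, e2]
    generalize Real.exp (-(((j : ℝ) + 1) * t)) = d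
    generalize powExpSum h (((j : ℝ) + 1) * t) = b
    generalize (j : ℝ) + 1 = c at hj
    field_simp
    ring
  rw [g5] at g4
  rw [g4.tsum_eq]
  ring

lemma sum_choose_mul_realZeta_neg (k : ℕ) :
    ∑ h ∈ Finset.range k, (k.choose h : ℝ) * realZeta (-(h : ℝ)) = -((k : ℝ) / (k + 1)) := by
  have h1 : ∀ h : ℕ, realZeta (-(h : ℝ)) = -((bernoulli' (h + 1) : ℚ) : ℝ) / (h + 1) := fun h => by
    have h2 := (exists_riemannZeta_neg_eq_and_integral h).1
    rw [riemannZeta_neg_nat_eq_bernoulli'] at h2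
    have h3 : ((-((bernoulli' (h + 1) : ℚ) : ℝ) / (h + 1) : ℝ) : ℂ) = (realZeta (-(h : ℝ)) : ℂ) := by
      rw [← h2]; push_cast; rfl
    exact_mod_cast h3.symm
  have h2 := sum_bernoulli' (k + 1)
  rw [Finset.sum_range_succ', bernoulli'_zero] at h2
  have h3 : ∑ h ∈ Finset.range k, ((k + 1).choose (h + 1) : ℝ) * ((bernoulli' (h + 1) : ℚ) : ℝ) =
      k := by
    have : ∑ h ∈ Finset.range k, ((k + 1).choose (h + 1) : ℚ) * bernoulli' (h + 1) = k := by
      simp at h2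
      linarith
    exact_mod_cast this
  have hk : (k : ℝ) + 1 ≠ 0 := by positivity
  rw [← neg_div, eq_div_iff hk, Finset.sum_mul]
  refine Eq.trans ?_ (congrArg Neg.neg h3)
  rw [← Finset.sum_neg_distrib]
  refine Finset.sum_congr rfl fun h _ => ?_
  have h4 : ((k : ℝ) + 1) * k.choose h = (k + 1).choose (h + 1) * (h + 1) := by
    exact_mod_cast Nat.add_one_mul_choose_eq k h
  have hh : (h : ℝ) + 1 ≠ 0 := by positivity
  rw [h1]
  field_simp
  linear_combination -((bernoulli' (h + 1) : ℚ) : ℝ) * h4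

/-- The number of indices `ℓ` with `⌊ℓ^(1/k)⌋ = m + 1`, as a real number. -/
noncomputable def partWeight (k m : ℕ) : ℝ := ((m : ℝ) + 2) ^ k - ((m : ℝ) + 1) ^ k

lemma partWeight_eq_sum (k m : ℕ) :
    partWeight k m = ∑ h ∈ Finset.range k, (k.choose h : ℝ) * ((m : ℝ) + 1) ^ h := by
  rw [partWeight, show (m : ℝ) + 2 = ((m : ℝ) + 1) + 1 by ring, add_pow, Finset.sum_range_succ]
  simp [mul_comm]

lemma partWeight_nonneg (k m : ℕ) : 0 ≤ partWeight k m := by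
  rw [partWeight_eq_sum]; positivity

/-- The `i`-th moment `∑ (c(m)/j) (mj)^i e^(-mjt)` of the logarithm of the generating function. -/
noncomputable def logGenMoment (k i : ℕ) (t : ℝ) : ℝ :=
  ∑' p : ℕ × ℕ, partWeight k p.2 / ((p.1 : ℝ) + 1) * (((p.2 : ℝ) + 1) * ((p.1 : ℝ) + 1)) ^ i *
    Real.exp (-(((p.2 : ℝ) + 1) * ((p.1 : ℝ) + 1) * t))

lemma hasSum_logGenMoment (k i : ℕ) {t : ℝ} (ht : 0 < t) :
    HasSum (fun p : ℕ × ℕ => partWeight k p.2 / ((p.1 : ℝ) + 1) *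
      (((p.2 : ℝ) + 1) * ((p.1 : ℝ) + 1)) ^ i *
      Real.exp (-(((p.2 : ℝ) + 1) * ((p.1 : ℝ) + 1) * t))) (logGenMoment k i t) ∧
    logGenMoment k i t =
      ∑ h ∈ Finset.range k, (k.choose h : ℝ) * divisorExpSum i (h + i) t := by
  have h1 := hasSum_sum (s := Finset.range k) fun h _ =>
    (summable_divisorExpSum_aux i (h + i) ht).1.hasSum.mul_left (k.choose h : ℝ)
  have h2 : (fun p : ℕ × ℕ => partWeight k p.2 / ((p.1 : ℝ) + 1) *
      (((p.2 : ℝ) + 1) * ((p.1 : ℝ) + 1)) ^ i *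
      Real.exp (-(((p.2 : ℝ) + 1) * ((p.1 : ℝ) + 1) * t))) = fun p : ℕ × ℕ =>
      ∑ h ∈ Finset.range k, (k.choose h : ℝ) * (((p.1 : ℝ) + 1) ^ i / ((p.1 : ℝ) + 1) *
      (((p.2 : ℝ) + 1) ^ (h + i) * Real.exp (-(((p.2 : ℝ) + 1) * (((p.1 : ℝ) + 1) * t))))) := by
    funext p
    rw [partWeight_eq_sum, Finset.sum_div, Finset.sum_mul, Finset.sum_mul]
    refine Finset.sum_congr rfl fun h _ => ?_
    rw [mul_pow, pow_add, mul_assoc ((p.2 : ℝ) + 1)]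
    ring
  rw [← h2] at h1
  exact ⟨h1.summable.hasSum, h1.tsum_eq⟩

/-- The coefficient of `t^(-(h + 1))` in the small-`t` expansion of the logarithm of the
generating function. -/
noncomputable def principalCoeff (k h : ℕ) : ℝ :=
  (k.choose h : ℝ) * ((h.factorial : ℝ) * realZeta ((h + 2 : ℕ) : ℝ))

lemma tendsto_logGenMoment_zero (k : ℕ) :
    Tendsto (fun t : ℝ => logGenMoment k 0 t -
      ∑ h ∈ Finset.range k, principalCoeff k h / t ^ (h + 1) - (k : ℝ) / (k + 1) * Real.log t)
      (𝓝[>] 0) (𝓝 (∑ h ∈ Finset.range k, (k.choose h : ℝ) * realZetaDeriv (-(h : ℝ)))) := by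
  have h1 := tendsto_finsetSum (Finset.range k) fun h _ =>
    (tendsto_divisorExpSum_zero h).const_mul (k.choose h : ℝ)
  refine h1.congr' ?_
  filter_upwards [self_mem_nhdsWithin] with t ht
  rw [(hasSum_logGenMoment k 0 ht).2, ← neg_neg ((k : ℝ) / (k + 1)),
    ← sum_choose_mul_realZeta_neg, neg_mul, Finset.sum_mul, sub_neg_eq_add,
    ← Finset.sum_sub_distrib, ← Finset.sum_add_distrib]
  refine Finset.sum_congr rfl fun h _ => ?_
  rw [principalCoeff, add_zero]
  ring

lemma abs_logGenMoment_sub_le (k i : ℕ) : ∃ C : ℝ, 0 ≤ C ∧ ∀ t : ℝ, 0 < t →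
    |logGenMoment k i t - ∑ h ∈ Finset.range k, (k.choose h : ℝ) *
      (((h + i).factorial : ℝ) * realZeta ((h + 2 : ℕ) : ℝ) / t ^ (h + i + 1))| ≤
      C * t ^ (-((i : ℝ) + 1 / 4)) := by
  choose C hC hb using fun h => abs_divisorExpSum_sub_le i h
  refine ⟨∑ h ∈ Finset.range k, (k.choose h : ℝ) * C h,
    Finset.sum_nonneg fun h _ => mul_nonneg (by positivity) (hC h).le, fun t ht => ?_⟩
  rw [(hasSum_logGenMoment k i ht).2, ← Finset.sum_sub_distrib, Finset.sum_mul]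
  refine (Finset.abs_sum_le_sum_abs _ _).trans (Finset.sum_le_sum fun h _ => ?_)
  rw [← mul_sub, abs_mul, Nat.abs_cast, mul_assoc]
  exact mul_le_mul_of_nonneg_left (hb h t ht) (by positivity)

lemma abs_logGenMoment_one_sub_le (k : ℕ) : ∃ C : ℝ, 0 ≤ C ∧ ∀ t : ℝ, 0 < t →
    |logGenMoment k 1 t - ∑ h ∈ Finset.range k, principalCoeff k h * (h + 1) / t ^ (h + 2)| ≤
      C * t ^ (-(5 / 4) : ℝ) := by
  obtain ⟨C, hC, h⟩ := abs_logGenMoment_sub_le k 1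
  refine ⟨C, hC, fun t ht => ?_⟩
  have h1 := h t ht
  have h2 : ∑ h ∈ Finset.range k, principalCoeff k h * (h + 1) / t ^ (h + 2) =
      ∑ h ∈ Finset.range k, (k.choose h : ℝ) *
        (((h + 1).factorial : ℝ) * realZeta ((h + 2 : ℕ) : ℝ) / t ^ (h + 1 + 1)) := by
    refine Finset.sum_congr rfl fun h _ => ?_
    rw [principalCoeff, Nat.factorial_succ]
    push_cast
    ring
  rw [h2]
  norm_num at h1 ⊢
  exact h1

lemma isLittleO_rpow_neg {a : ℝ} {n : ℕ} (h : a < n) :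
    Tendsto (fun t : ℝ => t ^ n * t ^ (-a)) (𝓝[>] 0) (𝓝 0) := by
  have h1 : Tendsto (fun t : ℝ => t ^ ((n : ℝ) - a)) (𝓝[>] 0) (𝓝 0) := by
    have := (Real.continuousAt_rpow_const (0 : ℝ) ((n : ℝ) - a) (Or.inr (by linarith))).tendsto
    rw [Real.zero_rpow (by linarith)] at this
    exact this.mono_left nhdsWithin_le_nhds
  refine h1.congr' ?_
  filter_upwards [self_mem_nhdsWithin] with t ht
  have ht : 0 < t := ht
  rw [sub_eq_add_neg, Real.rpow_add ht, Real.rpow_natCast]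

lemma tendsto_pow_mul_logGenMoment {k : ℕ} (hk : 1 ≤ k) (i : ℕ) :
    Tendsto (fun t : ℝ => t ^ (k + i) * logGenMoment k i t) (𝓝[>] 0)
      (𝓝 ((k : ℝ) * (((k - 1 + i).factorial : ℝ) * realZeta ((k : ℝ) + 1)))) := by
  obtain ⟨C, hC, hb⟩ := abs_logGenMoment_sub_le k i
  have h1 : Tendsto (fun t : ℝ => t ^ (k + i) * (logGenMoment k i t -
      ∑ h ∈ Finset.range k, (k.choose h : ℝ) *
      (((h + i).factorial : ℝ) * realZeta ((h + 2 : ℕ) : ℝ) / t ^ (h + i + 1)))) (𝓝[>] 0)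
      (𝓝 0) := by
    have h2 := (isLittleO_rpow_neg (a := (i : ℝ) + 1 / 4) (n := k + i) (by
      have : (1 : ℝ) ≤ k := by exact_mod_cast hk
      push_cast
      linarith)).const_mul C
    rw [mul_zero] at h2
    refine squeeze_zero_norm' ?_ h2
    filter_upwards [self_mem_nhdsWithin] with t ht
    have ht : 0 < t := ht
    rw [norm_mul, Real.norm_of_nonneg (by positivity), Real.norm_eq_abs]
    calc _ ≤ t ^ (k + i) * (C * t ^ (-((i : ℝ) + 1 / 4))) :=
          mul_le_mul_of_nonneg_left (hb t ht) (by positivity)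
      _ = _ := by ring
  have h3 : Tendsto (fun t : ℝ => ∑ h ∈ Finset.range k, (k.choose h : ℝ) *
      (((h + i).factorial : ℝ) * realZeta ((h + 2 : ℕ) : ℝ)) * t ^ (k - 1 - h)) (𝓝[>] 0)
      (𝓝 (∑ h ∈ Finset.range k, (k.choose h : ℝ) *
      (((h + i).factorial : ℝ) * realZeta ((h + 2 : ℕ) : ℝ)) * 0 ^ (k - 1 - h))) := by
    refine Tendsto.mono_left ?_ nhdsWithin_le_nhds
    exact (Continuous.tendsto (by fun_prop) 0)
  have h4 : ∑ h ∈ Finset.range k, (k.choose h : ℝ) *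
      (((h + i).factorial : ℝ) * realZeta ((h + 2 : ℕ) : ℝ)) * 0 ^ (k - 1 - h) =
      (k : ℝ) * (((k - 1 + i).factorial : ℝ) * realZeta ((k : ℝ) + 1)) := by
    rw [Finset.sum_eq_single_of_mem (k - 1) (Finset.mem_range.2 (by omega))]
    · have e1 : k.choose (k - 1) = k := by
        obtain ⟨n, rfl⟩ := Nat.exists_eq_succ_of_ne_zero (Nat.one_le_iff_ne_zero.1 hk)
        simp
      have e2 : ((k - 1 + 2 : ℕ) : ℝ) = (k : ℝ) + 1 := by
        rw [show k - 1 + 2 = k + 1 by omega]; push_cast; rfl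
      rw [e1, e2, Nat.sub_self, pow_zero, mul_one]
    · intro h hh hne
      have := Finset.mem_range.1 hh
      rw [zero_pow (by omega), mul_zero]
  rw [h4] at h3
  have h5 := h1.add h3
  rw [zero_add] at h5
  refine h5.congr' ?_
  filter_upwards [self_mem_nhdsWithin] with t ht
  have ht : 0 < t := ht
  rw [mul_sub, Finset.mul_sum]
  have h6 : ∑ h ∈ Finset.range k, t ^ (k + i) * ((k.choose h : ℝ) *
      (((h + i).factorial : ℝ) * realZeta ((h + 2 : ℕ) : ℝ) / t ^ (h + i + 1))) =
      ∑ h ∈ Finset.range k, (k.choose h : ℝ) *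
      (((h + i).factorial : ℝ) * realZeta ((h + 2 : ℕ) : ℝ)) * t ^ (k - 1 - h) := by
    refine Finset.sum_congr rfl fun h hh => ?_
    have := Finset.mem_range.1 hh
    have e1 : t ^ (k + i) = t ^ (k - 1 - h) * t ^ (h + i + 1) := by
      rw [← pow_add]; congr 1; omega
    rw [e1]
    field_simp
  rw [h6]
  ring

/-- The completely multiplicative function with prescribed values at the primes. -/
noncomputable def ofPrimeValues {K : Type*} [NormedField K] (a : ℕ → K) : ℕ →*₀ K where
  toFun n := if n = 0 then 0 else n.factorization.prod fun p j => a p ^ j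
  map_zero' := by simp
  map_one' := by simp
  map_mul' m n := by
    rcases eq_or_ne m 0 with rfl | hm
    · simp
    rcases eq_or_ne n 0 with rfl | hn
    · simp
    rw [if_neg hm, if_neg hn, if_neg (mul_ne_zero hm hn), Nat.factorization_mul hm hn,
      Finsupp.prod_add_index' (fun _ => pow_zero _) fun _ _ _ => pow_add _ _ _]

lemma ofPrimeValues_of_ne_zero {K : Type*} [NormedField K] (a : ℕ → K) {n : ℕ} (hn : n ≠ 0) :
    ofPrimeValues a n = n.factorization.prod fun p j => a p ^ j :=
  if_neg hn

lemma ofPrimeValues_prime {K : Type*} [NormedField K] (a : ℕ → K) {p : ℕ} (hp : p.Prime) :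
    ofPrimeValues a p = a p := by
  rw [ofPrimeValues_of_ne_zero a hp.ne_zero, hp.factorization,
    Finsupp.prod_single_index (h := fun q j => a q ^ j) (pow_zero _), pow_one]

lemma norm_ofPrimeValues {K : Type*} [NormedField K] (a : ℕ → K) (n : ℕ) :
    ‖ofPrimeValues a n‖ = ofPrimeValues (fun p => ‖a p‖) n := by
  rcases eq_or_ne n 0 with rfl | hn
  · simp
  · simp [ofPrimeValues_of_ne_zero _ hn, Finsupp.prod]

lemma summable_norm_ofPrimeValues {a : ℕ → ℂ} {ρ : ℝ} (hρ : ρ < 1)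
    (ha : ∀ p, ‖a p‖ ≤ ρ) (hs : Summable fun p : {p : ℕ // p.Prime} => ‖a p‖) :
    Summable fun n => ‖ofPrimeValues a n‖ := by
  simp only [norm_ofPrimeValues]
  set b : ℕ → ℝ := fun p => ‖a p‖ with hb
  have hb0 : ∀ p, 0 ≤ b p := fun p => norm_nonneg _
  have hnn : ∀ n, 0 ≤ ofPrimeValues b n := fun n => by
    rw [hb, ← norm_ofPrimeValues]; exact norm_nonneg _
  refine summable_of_sum_le hnn (c := Real.exp ((∑' p : {p : ℕ // p.Prime}, b p) / (1 - ρ))) fun T => ?_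
  set s : Finset ℕ := T.biUnion fun n => n.primeFactors with hsd
  have hlt : ∀ {p : ℕ}, p.Prime → ‖ofPrimeValues b p‖ < 1 := fun {p} hp => by
    rw [ofPrimeValues_prime b hp, Real.norm_of_nonneg (hb0 _)]
    exact (ha _).trans_lt hρ
  obtain ⟨h1, h2⟩ := EulerProduct.summable_and_hasSum_factoredNumbers_prod_filter_prime_geometric
    (f := (ofPrimeValues b).toMonoidHom) hlt s
  have h3 : ∑ n ∈ T, ofPrimeValues b n ≤
      ∏ p ∈ s with p.Prime, (1 - ofPrimeValues b p)⁻¹ := by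
    have h4 : ∑ n ∈ T, ofPrimeValues b n =
        ∑ n ∈ T.filter (· ∈ Nat.factoredNumbers s), ofPrimeValues b n := by
      rw [Finset.sum_filter_of_ne]
      intro n hn hne
      have hn0 : n ≠ 0 := by rintro rfl; simp at hne
      exact Nat.mem_factoredNumbers_of_primeFactors_subset hn0
        (Finset.subset_biUnion_of_mem (fun n : ℕ => n.primeFactors) hn)
    rw [h4, ← Finset.sum_subtype_eq_sum_filter]
    exact sum_le_hasSum _ (fun n _ => hnn _) h2
  refine h3.trans ?_
  have h5 : ∏ p ∈ s with p.Prime, (1 - ofPrimeValues b p)⁻¹ ≤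
      ∏ p ∈ s with p.Prime, Real.exp (ofPrimeValues b p / (1 - ρ)) := by
    refine Finset.prod_le_prod (fun p hp => ?_) fun p hp => ?_
    · have := hlt (Finset.mem_filter.1 hp).2
      rw [Real.norm_of_nonneg (hnn _)] at this
      exact inv_nonneg.2 (by linarith)
    · have hpp := (Finset.mem_filter.1 hp).2
      rw [ofPrimeValues_prime b hpp]
      have h6 := hb0 p
      have h7 : b p ≤ ρ := ha _
      set x := b p
      calc (1 - x)⁻¹ = x / (1 - x) + 1 := by
            have : 1 - x ≠ 0 := by linarith
            field_simp
            ring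
        _ ≤ x / (1 - ρ) + 1 := by
            have : 0 < 1 - ρ := by linarith
            gcongr
        _ ≤ _ := Real.add_one_le_exp _
  refine h5.trans ?_
  rw [← Real.exp_sum, ← Finset.sum_div]
  have h6 : 0 < 1 - ρ := by linarith
  gcongr
  rw [← Finset.sum_subtype_eq_sum_filter]
  have h7 : ∀ p : {p : ℕ // p.Prime}, ofPrimeValues b (p : ℕ) = b p := fun p =>
    ofPrimeValues_prime b p.2
  simp only [h7]
  exact Summable.sum_le_tsum (f := fun p : {p : ℕ // p.Prime} => b p) _ (fun p _ => hb0 p) hs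

lemma hasSum_finsupp_prod_pow {a : ℕ → ℂ} {ρ : ℝ} (hρ : ρ < 1)
    (ha : ∀ l, ‖a l‖ ≤ ρ) (hs : Summable fun l => ‖a l‖) :
    HasSum (fun r : ℕ →₀ ℕ => r.prod fun l j => a l ^ j)
      (Complex.exp (∑' l, -Complex.log (1 - a l))) := by
  have hnp : ∀ l, (Nat.nth Nat.Prime l).Prime := Nat.prime_nth_prime
  have hni : Function.Injective (Nat.nth Nat.Prime) :=
    Nat.nth_injective Nat.infinite_setOfPred_prime
  have hcn : ∀ l, Nat.count Nat.Prime (Nat.nth Nat.Prime l) = l :=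
    Nat.count_nth_of_infinite Nat.infinite_setOfPred_prime
  set e : ℕ ≃ Nat.Primes := Equiv.ofBijective (fun l => (⟨Nat.nth Nat.Prime l, hnp l⟩ : Nat.Primes))
    ⟨fun x y h => hni (congrArg Subtype.val h), fun p =>
      ⟨Nat.count Nat.Prime p, Subtype.ext (Nat.nth_count p.2)⟩⟩ with he
  set b : ℕ → ℂ := fun p => a (Nat.count Nat.Prime p) with hb
  have hbe : ∀ l, b (e l) = a l := fun l => congrArg a (hcn l)
  have hsF : Summable fun n => ‖ofPrimeValues b n‖ := by
    refine summable_norm_ofPrimeValues hρ (fun p => ha _) (e.summable_iff.1 ?_)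
    exact hs.congr fun l => congrArg norm (hbe l).symm
  have h1 := EulerProduct.exp_tsum_primes_log_eq_tsum hsF
  have h2 : ∑' p : Nat.Primes, -Complex.log (1 - ofPrimeValues b p) =
      ∑' l, -Complex.log (1 - a l) := by
    rw [← e.tsum_eq]
    exact tsum_congr fun l => by rw [ofPrimeValues_prime b (e l).2, hbe]
  rw [h2] at h1
  rw [h1]
  set E : (ℕ →₀ ℕ) → ℕ := fun r => (r.embDomain ⟨_, hni⟩).prod (· ^ ·) with hE
  have hsupp : ∀ r : ℕ →₀ ℕ, ∀ p ∈ (r.embDomain ⟨_, hni⟩).support, p.Prime := fun r p hp => by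
    rw [Finsupp.support_embDomain, Finset.mem_map] at hp
    obtain ⟨l, -, rfl⟩ := hp
    exact hnp l
  have hfac : ∀ r, (E r).factorization = r.embDomain ⟨_, hni⟩ := fun r =>
    Nat.prod_pow_factorization_eq_self (hsupp r)
  have hE0 : ∀ r, E r ≠ 0 := fun r =>
    Finset.prod_ne_zero_iff.2 fun p hp => pow_ne_zero _ (hsupp r p hp).ne_zero
  have hinj : Function.Injective E := fun r s h =>
    Finsupp.embDomain_injective _ (by rw [← hfac, ← hfac, h])
  have h3 := hsF.of_norm.hasSum
  rw [← hinj.hasSum_iff] at h3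
  · have h4 : (⇑(ofPrimeValues b) ∘ E) = fun r : ℕ →₀ ℕ => r.prod fun l j => a l ^ j := by
      funext r
      rw [Function.comp_apply, ofPrimeValues_of_ne_zero b (hE0 r), hfac, Finsupp.prod_embDomain]
      exact Finsupp.prod_congr fun l _ => congrArg (· ^ r l) (hbe l)
    rwa [h4] at h3
  · intro n hn
    have : n = 0 := by
      by_contra h0
      refine hn ⟨n.factorization.comapDomain _ hni.injOn, ?_⟩
      have h5 : (n.factorization.comapDomain _ hni.injOn).embDomain ⟨_, hni⟩ =
          n.factorization := by
        refine Finsupp.embDomain_comapDomain (f := ⟨_, hni⟩) fun p hp => ?_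
        exact ⟨Nat.count Nat.Prime p, Nat.nth_count (Nat.prime_of_mem_primeFactors hp)⟩
      rw [hE]
      dsimp only
      rw [h5, Nat.prod_factorization_pow_eq_self h0]
    simp [this]

lemma hasSum_card_fiber_mul {α : Type*} (w : α → ℕ) {H : ℕ → ℂ} {S : ℂ}
    (h : HasSum (fun x => H (w x)) S) :
    HasSum (fun m => (Nat.card {x // w x = m} : ℂ) * H m) S := by
  have h1 : HasSum (fun y : Σ m, {x // w x = m} => H (w y.2)) S :=
    (Equiv.sigmaFiberEquiv w).hasSum_iff.2 h
  refine h1.sigma fun m => ?_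
  have h2 : (fun y : {x // w x = m} => H (w y)) = fun _ => H m := by
    funext y; rw [y.2]
  have h3 := (h1.summable.sigma_factor m).hasSum
  simp only [h2] at h3
  rw [tsum_const, nsmul_eq_mul] at h3
  simpa only [h2] using h3

lemma hasSum_comp_of_card_fiber {α : Type*} (w : α → ℕ) {H : ℕ → ℂ}
    (hf : ∀ m, Finite {x // w x = m})
    (hs : Summable fun m => (Nat.card {x // w x = m} : ℝ) * ‖H m‖) :
    Summable (fun x => ‖H (w x)‖) ∧
      HasSum (fun x => H (w x)) (∑' m, (Nat.card {x // w x = m} : ℂ) * H m) := by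
  have h1 : Summable fun x => ‖H (w x)‖ := by
    refine (Equiv.sigmaFiberEquiv w).summable_iff.1 ?_
    have h2 : ∀ m (y : {x // w x = m}), ‖H (w y)‖ = ‖H m‖ := fun m y => by rw [y.2]
    refine (summable_sigma_of_nonneg fun _ => norm_nonneg _).2 ⟨fun m => ?_, ?_⟩
    · have := hf m
      exact Summable.of_finite
    · refine hs.congr fun m => ?_
      have h3 : ∑' y : {x // w x = m}, ‖H (w y)‖ = ∑' _ : {x // w x = m}, ‖H m‖ :=
        tsum_congr fun y => h2 m y
      exact (h3.trans (by rw [tsum_const, nsmul_eq_mul])).symm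
  refine ⟨h1, ?_⟩
  have h2 := h1.of_norm.hasSum
  rwa [(hasSum_card_fiber_mul w h2).tsum_eq]

lemma psPart_eq_iff {k : ℕ} (hk : 1 ≤ k) (l m : ℕ) :
    psPart (1 / (k : ℝ)) (l + 1) = m + 1 ↔ (m + 1) ^ k ≤ l + 1 ∧ l + 1 < (m + 2) ^ k := by
  have hk0 : (0 : ℝ) < k := by exact_mod_cast hk
  rw [psPart, Nat.floor_eq_iff (by positivity), one_div]
  refine and_congr ?_ ?_
  · rw [Real.le_rpow_inv_iff_of_pos (by positivity) (by positivity) hk0, Real.rpow_natCast]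
    norm_cast
  · rw [Real.rpow_inv_lt_iff_of_pos (by positivity) (by positivity) hk0, Real.rpow_natCast]
    norm_cast

lemma one_le_psPart {k : ℕ} (l : ℕ) : 1 ≤ psPart (1 / (k : ℝ)) (l + 1) := by
  refine Nat.le_floor ?_
  have : (1 : ℝ) ≤ ((l + 1 : ℕ) : ℝ) := by push_cast; linarith [Nat.cast_nonneg (α := ℝ) l]
  simpa using Real.one_le_rpow this (by positivity)

lemma card_psPart_fiber {k : ℕ} (hk : 1 ≤ k) (m : ℕ) :
    Finite {l // psPart (1 / (k : ℝ)) (l + 1) - 1 = m} ∧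
      (Nat.card {l // psPart (1 / (k : ℝ)) (l + 1) - 1 = m} : ℝ) = partWeight k m := by
  have h1 : ∀ l, psPart (1 / (k : ℝ)) (l + 1) - 1 = m ↔
      l ∈ Finset.Ico ((m + 1) ^ k - 1) ((m + 2) ^ k - 1) := fun l => by
    have h2 := one_le_psPart (k := k) l
    have h3 : 1 ≤ (m + 1) ^ k := Nat.one_le_pow _ _ (Nat.succ_pos _)
    rw [Finset.mem_Ico, show psPart (1 / (k : ℝ)) (l + 1) - 1 = m ↔
      psPart (1 / (k : ℝ)) (l + 1) = m + 1 by omega, psPart_eq_iff hk]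
    omega
  simp only [h1]
  refine ⟨inferInstance, ?_⟩
  have h3 : 1 ≤ (m + 1) ^ k := Nat.one_le_pow _ _ (Nat.succ_pos _)
  have h4 : (m + 1) ^ k ≤ (m + 2) ^ k := Nat.pow_le_pow_left (by omega) _
  rw [Nat.card_eq_fintype_card, Fintype.card_coe, Nat.card_Ico, partWeight,
    show (m + 2) ^ k - 1 - ((m + 1) ^ k - 1) = (m + 2) ^ k - (m + 1) ^ k by omega,
    Nat.cast_sub h4]
  push_cast
  ring

/-- The logarithm of the generating function of `pk (1/k)`, in the variable `e^(-z)`. -/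
noncomputable def logGen (k : ℕ) (z : ℂ) : ℂ :=
  ∑' p : ℕ × ℕ, (partWeight k p.2 / ((p.1 : ℝ) + 1) : ℝ) *
    Complex.exp (-(((p.2 : ℂ) + 1) * ((p.1 : ℂ) + 1) * z))

lemma norm_logGen_term (k : ℕ) (z : ℂ) (p : ℕ × ℕ) :
    ‖((partWeight k p.2 / ((p.1 : ℝ) + 1) : ℝ) : ℂ) *
      Complex.exp (-(((p.2 : ℂ) + 1) * ((p.1 : ℂ) + 1) * z))‖ =
    partWeight k p.2 / ((p.1 : ℝ) + 1) *
      Real.exp (-(((p.2 : ℝ) + 1) * ((p.1 : ℝ) + 1) * z.re)) := by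
  have h1 := partWeight_nonneg k p.2
  rw [norm_mul, Complex.norm_exp, Complex.norm_real, Real.norm_of_nonneg (by positivity)]
  congr 2
  rw [Complex.neg_re, show ((p.2 : ℂ) + 1) * ((p.1 : ℂ) + 1) =
    ((((p.2 : ℝ) + 1) * ((p.1 : ℝ) + 1) : ℝ) : ℂ) by push_cast; ring, Complex.re_ofReal_mul]

lemma summable_norm_logGen (k : ℕ) {z : ℂ} (hz : 0 < z.re) :
    Summable fun p : ℕ × ℕ => ‖((partWeight k p.2 / ((p.1 : ℝ) + 1) : ℝ) : ℂ) *
      Complex.exp (-(((p.2 : ℂ) + 1) * ((p.1 : ℂ) + 1) * z))‖ := by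
  simp only [norm_logGen_term]
  simpa using (hasSum_logGenMoment k 0 hz).1.summable

lemma hasSum_pk_mul_exp {k : ℕ} (hk : 1 ≤ k) {z : ℂ} (hz : 0 < z.re) :
    HasSum (fun n : ℕ => (pk (1 / (k : ℝ)) n : ℂ) * Complex.exp (-(n * z)))
      (Complex.exp (logGen k z)) := by
  set w : ℕ → ℕ := fun l => psPart (1 / (k : ℝ)) (l + 1) - 1 with hw
  have hwv : ∀ l, ((psPart (1 / (k : ℝ)) (l + 1) : ℕ) : ℂ) = w l + 1 := fun l => by
    rw [hw]; push_cast [one_le_psPart (k := k) l]; ring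
  have hcard : ∀ m, (Nat.card {l // w l = m} : ℝ) = partWeight k m := fun m =>
    (card_psPart_fiber hk m).2
  have hcardC : ∀ m, (Nat.card {l // w l = m} : ℂ) = (partWeight k m : ℂ) := fun m => by
    rw [← hcard]; simp
  have hfin : ∀ m, Finite {l // w l = m} := fun m => (card_psPart_fiber hk m).1
  have hsn := summable_norm_logGen k hz
  have hexp : ∀ m : ℕ, ‖Complex.exp (-((m + 1) * z))‖ = Real.exp (-((m + 1) * z.re)) := fun m => by
    rw [Complex.norm_exp, Complex.neg_re, show ((m : ℂ) + 1) = (((m : ℝ) + 1 : ℝ) : ℂ) by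
      push_cast; ring, Complex.re_ofReal_mul]
  have hexple : ∀ m : ℕ, ‖Complex.exp (-((m + 1) * z))‖ ≤ Real.exp (-z.re) := fun m => by
    rw [hexp]
    refine Real.exp_le_exp.2 ?_
    nlinarith [Nat.cast_nonneg (α := ℝ) m]
  have hlt : Real.exp (-z.re) < 1 := by rw [Real.exp_lt_one_iff]; linarith
  have hlog : ∀ m : ℕ, HasSum (fun j : ℕ => ((1 / ((j : ℝ) + 1) : ℝ) : ℂ) *
      Complex.exp (-(((m : ℂ) + 1) * ((j : ℂ) + 1) * z)))
      (-Complex.log (1 - Complex.exp (-((m + 1) * z)))) := fun m => by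
    have h1 := (hasSum_nat_add_iff' 1).2
      (Complex.hasSum_taylorSeries_neg_log ((hexple m).trans_lt hlt))
    simp only [Finset.sum_range_one, pow_zero, Nat.cast_zero, div_zero, sub_zero] at h1
    refine h1.congr_fun fun j => ?_
    rw [← Complex.exp_nat_mul]
    push_cast
    rw [one_div, div_eq_inv_mul]
    congr 2
    ring
  have hrow : ∀ m : ℕ, HasSum (fun j : ℕ => ((partWeight k m / ((j : ℝ) + 1) : ℝ) : ℂ) *
      Complex.exp (-(((m : ℂ) + 1) * ((j : ℂ) + 1) * z)))
      ((partWeight k m : ℂ) * -Complex.log (1 - Complex.exp (-((m + 1) * z)))) := fun m => by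
    refine ((hlog m).mul_left (partWeight k m : ℂ)).congr_fun fun j => ?_
    push_cast
    ring
  have hswap := (Equiv.prodComm ℕ ℕ).summable_iff.2 hsn
  have hsumlog : HasSum (fun m : ℕ => (partWeight k m : ℂ) *
      -Complex.log (1 - Complex.exp (-((m + 1) * z)))) (logGen k z) :=
    ((Equiv.prodComm ℕ ℕ).hasSum_iff.2 hsn.of_norm.hasSum).prod_fiberwise hrow
  have hsumlogn : Summable fun m : ℕ => partWeight k m *
      ‖-Complex.log (1 - Complex.exp (-((m + 1) * z)))‖ := by
    refine Summable.of_nonneg_of_le (fun m => mul_nonneg (partWeight_nonneg k m) (norm_nonneg _))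
      (fun m => ?_) hswap.prod
    have h1 := (hrow m).tsum_eq ▸ norm_tsum_le_tsum_norm (hswap.prod_factor m)
    rwa [norm_mul, Complex.norm_real, Real.norm_of_nonneg (partWeight_nonneg k m)] at h1
  have hone : Summable fun m : ℕ => partWeight k m * ‖Complex.exp (-((m + 1) * z))‖ := by
    have h1 := hsn.comp_injective (i := fun m : ℕ => ((0, m) : ℕ × ℕ))
      fun x y h => congrArg Prod.snd h
    refine h1.congr fun m => ?_
    rw [Function.comp_apply, norm_logGen_term, hexp]
    simp
  have hA := hasSum_comp_of_card_fiber w (H := fun m => Complex.exp (-((m + 1) * z))) hfin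
    (by simpa only [hcard] using hone)
  have hL := hasSum_comp_of_card_fiber w
    (H := fun m => -Complex.log (1 - Complex.exp (-((m + 1) * z)))) hfin
    (by simpa only [hcard] using hsumlogn)
  have hF := hasSum_finsupp_prod_pow hlt (a := fun l => Complex.exp (-((w l + 1) * z)))
    (fun l => hexple (w l)) hA.1
  rw [hL.2.tsum_eq] at hF
  simp only [hcardC] at hF
  rw [hsumlog.tsum_eq] at hF
  refine hasSum_card_fiber_mul (fun r : ℕ →₀ ℕ => r.sum fun l j => j * psPart (1 / (k : ℝ)) (l + 1))
    (H := fun n => Complex.exp (-(n * z))) (hF.congr_fun fun r => ?_)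
  rw [Finsupp.prod, Finsupp.sum]
  push_cast
  rw [Finset.sum_mul, ← Finset.sum_neg_distrib, Complex.exp_sum]
  refine Finset.prod_congr rfl fun l _ => ?_
  rw [← Complex.exp_nat_mul, hwv]
  congr 1
  ring

lemma integral_exp_int_mul_I (m : ℤ) :
    ∫ θ in (-π)..π, Complex.exp ((m : ℂ) * Complex.I * θ) = if m = 0 then (2 * π : ℂ) else 0 := by
  split_ifs with h
  · subst h
    simp
    ring
  · have hc : (m : ℂ) * Complex.I ≠ 0 := mul_ne_zero (by exact_mod_cast h) Complex.I_ne_zero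
    rw [integral_exp_mul_complex hc, div_eq_zero_iff]
    left
    rw [sub_eq_zero, Complex.exp_eq_exp_iff_exists_int]
    exact ⟨m, by push_cast; ring⟩

lemma integral_exp_logGen {k : ℕ} (hk : 1 ≤ k) {t : ℝ} (ht : 0 < t) (n : ℕ) :
    ∫ θ in (-π)..π, Complex.exp (logGen k (t + θ * Complex.I) + n * (t + θ * Complex.I)) =
      2 * π * (pk (1 / (k : ℝ)) n : ℂ) := by
  have hre : ∀ θ : ℝ, (t + θ * Complex.I : ℂ).re = t := fun θ => by simp
  have hz : ∀ θ : ℝ, 0 < (t + θ * Complex.I : ℂ).re := fun θ => by rw [hre]; exact ht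
  set F : ℕ → ℝ → ℂ := fun m θ => (pk (1 / (k : ℝ)) m : ℂ) *
    Complex.exp (-(m * (t + θ * Complex.I))) * Complex.exp (n * (t + θ * Complex.I)) with hF
  have hFn : ∀ m θ, ‖F m θ‖ = (pk (1 / (k : ℝ)) m : ℝ) * Real.exp (-(m * t)) * Real.exp (n * t) :=
    fun m θ => by simp [hF, Complex.norm_exp]
  have hsum : ∀ θ, HasSum (fun m => F m θ)
      (Complex.exp (logGen k (t + θ * Complex.I) + n * (t + θ * Complex.I))) := fun θ => by
    rw [Complex.exp_add]
    exact (hasSum_pk_mul_exp hk (hz θ)).mul_right _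
  have hsn : Summable fun m : ℕ => (pk (1 / (k : ℝ)) m : ℝ) * Real.exp (-(m * t)) *
      Real.exp (n * t) := by
    simpa only [hFn] using (hsum 0).summable.norm
  have h1 := intervalIntegral.hasSum_integral_of_dominated_convergence (F := F) (a := -π) (b := π)
    (μ := MeasureTheory.volume) (fun m _ => (pk (1 / (k : ℝ)) m : ℝ) * Real.exp (-(m * t)) *
      Real.exp (n * t)) (fun m => by
        refine Continuous.aestronglyMeasurable ?_
        rw [hF]; fun_prop)
    (fun m => Eventually.of_forall fun θ _ => (hFn m θ).le)
    (Eventually.of_forall fun θ _ => hsn) (by simp) (Eventually.of_forall fun θ _ => hsum θ)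
  have h2 : ∀ m : ℕ, ∫ θ in (-π)..π, F m θ =
      if m = n then 2 * π * (pk (1 / (k : ℝ)) n : ℂ) else 0 := fun m => by
    have h3 : ∀ θ : ℝ, F m θ = ((pk (1 / (k : ℝ)) m : ℂ) * Complex.exp (((n : ℂ) - m) * t)) *
        Complex.exp ((((n : ℤ) - m : ℤ) : ℂ) * Complex.I * θ) := fun θ => by
      rw [hF]
      simp only [mul_assoc, ← Complex.exp_add]
      congr 2
      push_cast
      ring
    simp only [h3]
    rw [intervalIntegral.integral_const_mul, integral_exp_int_mul_I]
    rcases eq_or_ne m n with rfl | h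
    · simp
      ring
    · rw [if_neg (sub_ne_zero.2 (by exact_mod_cast h.symm)), if_neg h, mul_zero]
  simp only [h2] at h1
  exact h1.unique (hasSum_ite_eq n _)

lemma norm_exp_neg_mul_I_sub_le (y : ℝ) :
    ‖Complex.exp (-(y * Complex.I)) - (1 - y * Complex.I - y ^ 2 / 2)‖ ≤ 4 * |y| ^ 3 := by
  have hn : ‖-((y : ℂ) * Complex.I)‖ = |y| := by simp
  have hI := Complex.I_sq
  rcases le_total |y| 1 with h | h
  · have h1 := Complex.exp_bound (x := -(y * Complex.I)) (by rw [hn]; exact h) (n := 3) (by norm_num)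
    have h2 : ∑ m ∈ Finset.range 3, (-((y : ℂ) * Complex.I)) ^ m / (m.factorial : ℂ) =
        1 - y * Complex.I - y ^ 2 / 2 := by
      simp [Finset.sum_range_succ, Nat.factorial]
      linear_combination (y : ℂ) ^ 2 / 2 * hI
    rw [h2, hn] at h1
    refine h1.trans ?_
    norm_num [Nat.factorial]
    nlinarith [pow_nonneg (abs_nonneg y) 3]
  · have h1 : ‖Complex.exp (-(y * Complex.I))‖ = 1 := by simp [Complex.norm_exp]
    have h2 : ‖(1 - y * Complex.I - y ^ 2 / 2 : ℂ)‖ ≤ 1 + |y| + |y| ^ 2 / 2 := by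
      refine (norm_sub_le _ _).trans <| add_le_add ((norm_sub_le _ _).trans ?_) ?_
      · simp
      · simp
    refine (norm_sub_le _ _).trans ?_
    have h3 : |y| ≤ |y| ^ 3 := le_self_pow₀ h (by norm_num)
    have h4 : |y| ^ 2 ≤ |y| ^ 3 := pow_le_pow_right₀ h (by norm_num)
    linarith

lemma logGen_add_mul_I_sub (k : ℕ) {t : ℝ} (ht : 0 < t) (θ : ℝ) :
    HasSum (fun p : ℕ × ℕ => ((partWeight k p.2 / ((p.1 : ℝ) + 1) *
      Real.exp (-(((p.2 : ℝ) + 1) * ((p.1 : ℝ) + 1) * t)) : ℝ) : ℂ) *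
      (Complex.exp (-((((p.2 : ℝ) + 1) * ((p.1 : ℝ) + 1) * θ : ℝ) * Complex.I)) - 1))
      (logGen k (t + θ * Complex.I) - logGenMoment k 0 t) := by
  have hz : 0 < (t + θ * Complex.I : ℂ).re := by simpa using ht
  have h1 := (summable_norm_logGen k hz).of_norm.hasSum
  have h2 := Complex.hasSum_ofReal.2 (hasSum_logGenMoment k 0 ht).1
  refine (h1.sub h2).congr_fun fun p => ?_
  push_cast
  rw [mul_sub, mul_assoc, ← Complex.exp_add]
  have h3 : -(((p.2 : ℂ) + 1) * (p.1 + 1) * t) + -(((p.2 : ℂ) + 1) * (p.1 + 1) * θ * Complex.I) =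
    -(((p.2 : ℂ) + 1) * (p.1 + 1) * (t + θ * Complex.I)) := by ring
  rw [h3]
  ring

lemma norm_logGen_add_mul_I_sub_le (k : ℕ) {t : ℝ} (ht : 0 < t) (θ : ℝ) :
    ‖logGen k (t + θ * Complex.I) - logGenMoment k 0 t -
      (-(θ * logGenMoment k 1 t * Complex.I) - θ ^ 2 / 2 * logGenMoment k 2 t)‖ ≤
      4 * |θ| ^ 3 * logGenMoment k 3 t := by
  have h1 := ((logGen_add_mul_I_sub k ht θ).add ((Complex.hasSum_ofReal.2
    (hasSum_logGenMoment k 1 ht).1).mul_left (θ * Complex.I))).add ((Complex.hasSum_ofReal.2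
    (hasSum_logGenMoment k 2 ht).1).mul_left (θ ^ 2 / 2 : ℂ))
  have h2 := (hasSum_logGenMoment k 3 ht).1.mul_left (4 * |θ| ^ 3)
  have h3 : logGen k (t + θ * Complex.I) - logGenMoment k 0 t -
      (-(θ * logGenMoment k 1 t * Complex.I) - θ ^ 2 / 2 * logGenMoment k 2 t) =
      logGen k (t + θ * Complex.I) - logGenMoment k 0 t +
      θ * Complex.I * logGenMoment k 1 t + θ ^ 2 / 2 * logGenMoment k 2 t := by ring
  rw [h3, ← h1.tsum_eq]
  refine tsum_of_norm_bounded h2 fun p => ?_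
  have hw := partWeight_nonneg k p.2
  set c : ℝ := partWeight k p.2 / ((p.1 : ℝ) + 1) *
      Real.exp (-(((p.2 : ℝ) + 1) * ((p.1 : ℝ) + 1) * t)) with hc
  have hc0 : 0 ≤ c := by positivity
  set μ : ℝ := ((p.2 : ℝ) + 1) * ((p.1 : ℝ) + 1) with hμ
  have hμ0 : 0 ≤ μ := by positivity
  have h4 := norm_exp_neg_mul_I_sub_le (μ * θ)
  have h5 : (c : ℂ) * (Complex.exp (-(((μ * θ : ℝ) : ℂ) * Complex.I)) - 1) +
      θ * Complex.I * ((partWeight k p.2 / ((p.1 : ℝ) + 1) * μ ^ 1 * Real.exp (-(μ * t)) : ℝ) : ℂ) +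
      θ ^ 2 / 2 * ((partWeight k p.2 / ((p.1 : ℝ) + 1) * μ ^ 2 * Real.exp (-(μ * t)) : ℝ) : ℂ) =
      c * (Complex.exp (-(((μ * θ : ℝ) : ℂ) * Complex.I)) -
        (1 - ((μ * θ : ℝ) : ℂ) * Complex.I - ((μ * θ : ℝ) : ℂ) ^ 2 / 2)) := by
    rw [hc]
    push_cast
    ring
  refine (congrArg norm h5).le.trans ?_
  rw [norm_mul, Complex.norm_real, Real.norm_of_nonneg hc0]
  refine (mul_le_mul_of_nonneg_left h4 hc0).trans (le_of_eq ?_)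
  rw [abs_mul, abs_of_nonneg hμ0, hc]
  ring

lemma two_div_pi_sq_mul_sq_le_one_sub_cos {x : ℝ} (hx : |x| ≤ π) :
    2 / π ^ 2 * x ^ 2 ≤ 1 - Real.cos x := by
  have h1 : |x / 2| ≤ π / 2 := by rw [abs_div, abs_two]; linarith
  have h2 := Real.mul_abs_le_abs_sin h1
  have h3 : (2 / π * |x / 2|) ^ 2 ≤ |Real.sin (x / 2)| ^ 2 := by gcongr
  rw [mul_pow, sq_abs, sq_abs] at h3
  have h4 : Real.cos x = 1 - 2 * Real.sin (x / 2) ^ 2 := by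
    have h := Real.cos_two_mul (x / 2)
    rw [show 2 * (x / 2) = x by ring] at h
    linarith [Real.sin_sq_add_cos_sq (x / 2)]
  rw [h4]
  have h5 : 2 / π ^ 2 * x ^ 2 = 2 * ((2 / π) ^ 2 * (x / 2) ^ 2) := by ring
  linarith

lemma sum_cos_le {θ : ℝ} (hθ : |θ| ≤ π) (h0 : θ ≠ 0) (a b : ℕ) (hab : a ≤ b) :
    ∑ μ ∈ Finset.Ico a b, Real.cos (μ * θ) ≤ π / |θ| := by
  have hπ := Real.pi_pos
  have h1 : ∑ μ ∈ Finset.Ico a b, Real.cos (μ * θ) =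
      (∑ μ ∈ Finset.Ico a b, Complex.exp (Complex.I * θ) ^ μ).re := by
    rw [Complex.re_sum]
    refine Finset.sum_congr rfl fun μ _ => ?_
    rw [← Complex.exp_nat_mul, show (μ : ℂ) * (Complex.I * θ) = ((μ * θ : ℝ) : ℂ) * Complex.I by
      push_cast; ring, Complex.exp_ofReal_mul_I_re]
  have h2 : 2 / π * |θ / 2| ≤ |Real.sin (θ / 2)| :=
    Real.mul_abs_le_abs_sin (by rw [abs_div, abs_two]; linarith)
  have h3 : 0 < |θ| := abs_pos.2 h0
  have h4 : 2 * |θ| / π ≤ ‖Complex.exp (Complex.I * θ) - 1‖ := by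
    rw [Complex.norm_exp_I_mul_ofReal_sub_one, norm_mul, Real.norm_eq_abs, Real.norm_eq_abs,
      abs_two]
    rw [abs_div, abs_two] at h2
    calc 2 * |θ| / π = 2 * (2 / π * (|θ| / 2)) := by ring
      _ ≤ _ := by gcongr
  have h5 : 0 < ‖Complex.exp (Complex.I * θ) - 1‖ := lt_of_lt_of_le (by positivity) h4
  have h6 : Complex.exp (Complex.I * θ) ≠ 1 := fun h => by simp [h] at h5
  have h7 : ∀ m : ℕ, ‖Complex.exp (Complex.I * θ) ^ m‖ = 1 := fun m => by
    rw [norm_pow, mul_comm, Complex.norm_exp_ofReal_mul_I, one_pow]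
  rw [h1, geom_sum_Ico h6 hab]
  refine (Complex.re_le_norm _).trans ?_
  rw [norm_div]
  calc ‖Complex.exp (Complex.I * θ) ^ b - Complex.exp (Complex.I * θ) ^ a‖ /
        ‖Complex.exp (Complex.I * θ) - 1‖ ≤ 2 / (2 * |θ| / π) := by
        gcongr
        refine (norm_sub_le _ _).trans ?_
        rw [h7, h7]; norm_num
    _ = π / |θ| := by field_simp

lemma re_logGen_sub_le {k : ℕ} (hk : 1 ≤ k) {t : ℝ} (ht : 0 < t) (θ : ℝ) {N : ℕ} (hN : 1 ≤ N) :
    (logGen k (t + θ * Complex.I)).re - logGenMoment k 0 t ≤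
      -((N : ℝ) ^ (k - 1) * Real.exp (-(2 * N * t)) *
        ∑ μ ∈ Finset.Ico N (2 * N), (1 - Real.cos (μ * θ))) := by
  have h1 := Complex.hasSum_re (logGen_add_mul_I_sub k ht θ)
  simp only [Complex.re_ofReal_mul, Complex.sub_re, Complex.one_re, Complex.ofReal_re] at h1
  have hcos : ∀ x : ℝ, (Complex.exp (-((x : ℂ) * Complex.I))).re = Real.cos x := fun x => by
    rw [← neg_mul, ← Complex.ofReal_neg, Complex.exp_ofReal_mul_I_re, Real.cos_neg]
  simp only [hcos] at h1
  set f : ℕ × ℕ → ℝ := fun p => partWeight k p.2 / ((p.1 : ℝ) + 1) *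
    Real.exp (-(((p.2 : ℝ) + 1) * ((p.1 : ℝ) + 1) * t)) *
    (Real.cos (((p.2 : ℝ) + 1) * ((p.1 : ℝ) + 1) * θ) - 1) with hf
  have hneg : ∀ p, 0 ≤ -f p := fun p => by
    have hw := partWeight_nonneg k p.2
    have hc := Real.cos_le_one (((p.2 : ℝ) + 1) * ((p.1 : ℝ) + 1) * θ)
    rw [hf]
    dsimp only
    rw [← mul_neg]
    have : 0 ≤ -(Real.cos (((p.2 : ℝ) + 1) * ((p.1 : ℝ) + 1) * θ) - 1) := by linarith
    positivity
  have h2 := sum_le_hasSum ((Finset.Ico (N - 1) (2 * N - 1)).image fun m => ((0, m) : ℕ × ℕ))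
    (fun p _ => hneg p) h1.neg
  rw [Finset.sum_image fun x _ y _ h => congrArg Prod.snd h] at h2
  refine (le_neg.2 (le_trans ?_ h2))
  have h3 : Finset.Ico N (2 * N) = (Finset.Ico (N - 1) (2 * N - 1)).image (· + 1) := by
    rw [Finset.image_add_right_Ico]
    congr 1 <;> omega
  rw [h3, Finset.sum_image fun x _ y _ h => Nat.succ_injective h, Finset.mul_sum]
  refine Finset.sum_le_sum fun m hm => ?_
  rw [Finset.mem_Ico] at hm
  have hm1 : (N : ℝ) ≤ (m : ℝ) + 1 := by exact_mod_cast (by omega : N ≤ m + 1)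
  have hm2 : (m : ℝ) + 1 ≤ 2 * N := by exact_mod_cast (by omega : m + 1 ≤ 2 * N)
  have hw : (N : ℝ) ^ (k - 1) ≤ partWeight k m := by
    rw [partWeight_eq_sum]
    have h4 := Finset.single_le_sum (f := fun h => (k.choose h : ℝ) * ((m : ℝ) + 1) ^ h)
      (fun i _ => by positivity) (Finset.mem_range.2 (by omega : k - 1 < k))
    refine le_trans ?_ h4
    have h5 : (1 : ℝ) ≤ k.choose (k - 1) := by
      exact_mod_cast Nat.choose_pos (Nat.sub_le k 1)
    calc (N : ℝ) ^ (k - 1) ≤ ((m : ℝ) + 1) ^ (k - 1) := by gcongr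
      _ ≤ _ := le_mul_of_one_le_left (by positivity) h5
  have hc := Real.cos_le_one (((m : ℝ) + 1) * θ)
  have hfm : -f (0, m) = partWeight k m * Real.exp (-(((m : ℝ) + 1) * t)) *
      (1 - Real.cos (((m : ℝ) + 1) * θ)) := by
    rw [hf]
    simp
    ring
  rw [hfm]
  push_cast
  have : 0 ≤ 1 - Real.cos (((m : ℝ) + 1) * θ) := by linarith
  have := partWeight_nonneg k m
  gcongr

lemma exists_exp_re_logGen_sub_le {k : ℕ} (hk : 1 ≤ k) : ∃ C : ℝ, 0 < C ∧
    ∀ t : ℝ, 0 < t → t ≤ 1 → ∀ θ : ℝ, |θ| ≤ π →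
      Real.exp ((logGen k (t + θ * Complex.I)).re - logGenMoment k 0 t) ≤ 1 ∧
      Real.exp ((logGen k (t + θ * Complex.I)).re - logGenMoment k 0 t) * θ ^ 2 ≤
        C * t ^ (k + 2) := by
  have hπ := Real.pi_pos
  set c₁ : ℝ := Real.exp (-4) * (2 / π ^ 2) with hc₁
  set c₂ : ℝ := Real.exp (-34) / 2 with hc₂
  have hc₁0 : 0 < c₁ := by positivity
  have hc₂0 : 0 < c₂ := by positivity
  refine ⟨1 / c₁ + π ^ 2 * 6 / c₂ ^ 3, by positivity, fun t ht ht1 θ hθ => ⟨?_, ?_⟩⟩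
  · rw [Real.exp_le_one_iff]
    refine (re_logGen_sub_le hk ht θ le_rfl).trans (neg_nonpos.2 ?_)
    refine mul_nonneg (by positivity) (Finset.sum_nonneg fun μ _ => ?_)
    linarith [Real.cos_le_one ((μ : ℝ) * θ)]
  have hkk : ∀ {x : ℝ}, x ^ (k - 1) * x = x ^ k := fun {x} => by
    rw [← pow_succ, Nat.sub_add_cancel hk]
  have ceil : ∀ {a : ℝ}, 1 ≤ a → ∃ N : ℕ, 1 ≤ N ∧ a / t ≤ N ∧ N * t ≤ a + 1 := fun {a} ha => by
    refine ⟨⌈a / t⌉₊, Nat.one_le_ceil_iff.2 (by positivity), Nat.le_ceil _, ?_⟩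
    have h1 := (Nat.ceil_lt_add_one (by positivity : 0 ≤ a / t)).le
    calc (⌈a / t⌉₊ : ℝ) * t ≤ (a / t + 1) * t := by gcongr
      _ = a + t := by field_simp
      _ ≤ a + 1 := by linarith
  rcases le_total |θ| (t / 2) with h | h
  · obtain ⟨N, hN, hN1, hN2⟩ := ceil le_rfl
    have h1 := re_logGen_sub_le hk ht θ hN
    have h2 : c₁ * (θ ^ 2 / t ^ (k + 2)) ≤ (N : ℝ) ^ (k - 1) * Real.exp (-(2 * N * t)) *
        ∑ μ ∈ Finset.Ico N (2 * N), (1 - Real.cos (μ * θ)) := by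
      have h3 : (N : ℝ) * (2 / π ^ 2 * ((N : ℝ) * θ) ^ 2) ≤
          ∑ μ ∈ Finset.Ico N (2 * N), (1 - Real.cos (μ * θ)) := by
        have h4 := Finset.card_nsmul_le_sum (Finset.Ico N (2 * N))
          (fun μ : ℕ => 1 - Real.cos (μ * θ)) (2 / π ^ 2 * ((N : ℝ) * θ) ^ 2) fun μ hμ => by
            rw [Finset.mem_Ico] at hμ
            have hμ1 : (N : ℝ) ≤ μ := by exact_mod_cast hμ.1
            have hμ2 : (μ : ℝ) ≤ 2 * N := by exact_mod_cast hμ.2.le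
            refine le_trans ?_ (two_div_pi_sq_mul_sq_le_one_sub_cos ?_)
            · rw [mul_pow, mul_pow]
              gcongr
            · rw [abs_mul, Nat.abs_cast]
              calc (μ : ℝ) * |θ| ≤ 2 * N * (t / 2) := by gcongr
                _ = N * t := by ring
                _ ≤ 1 + 1 := hN2
                _ ≤ π := by linarith [Real.pi_gt_three]
        rwa [Nat.card_Ico, nsmul_eq_mul, show 2 * N - N = N by omega] at h4
      have h5 : Real.exp (-4) ≤ Real.exp (-(2 * N * t)) := Real.exp_le_exp.2 (by linarith)
      calc c₁ * (θ ^ 2 / t ^ (k + 2)) =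
            (1 / t) ^ (k - 1) * Real.exp (-4) * (1 / t * (2 / π ^ 2 * (1 / t * θ) ^ 2)) := by
            rw [hc₁, pow_add, ← hkk, one_div_pow]
            field_simp
        _ ≤ (N : ℝ) ^ (k - 1) * Real.exp (-(2 * N * t)) *
            (N * (2 / π ^ 2 * ((N : ℝ) * θ) ^ 2)) := by
            rw [mul_pow, mul_pow]
            gcongr
        _ ≤ _ := by gcongr
    set X := θ ^ 2 / t ^ (k + 2) with hX
    have hX0 : 0 ≤ X := by positivity
    have h6 : Real.exp ((logGen k (t + θ * Complex.I)).re - logGenMoment k 0 t) * (c₁ * X) ≤ 1 := by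
      calc _ ≤ Real.exp (-(c₁ * X)) * (c₁ * X) := by
            gcongr
            linarith
        _ ≤ Real.exp (-(c₁ * X)) * Real.exp (c₁ * X) := by
            gcongr
            linarith [Real.add_one_le_exp (c₁ * X)]
        _ = 1 := by rw [← Real.exp_add]; simp
    have h7 : θ ^ 2 = X * t ^ (k + 2) := by rw [hX]; field_simp
    calc Real.exp ((logGen k (t + θ * Complex.I)).re - logGenMoment k 0 t) * θ ^ 2 =
          Real.exp ((logGen k (t + θ * Complex.I)).re - logGenMoment k 0 t) * (c₁ * X) *
            (1 / c₁ * t ^ (k + 2)) := by rw [h7]; field_simp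
      _ ≤ 1 * (1 / c₁ * t ^ (k + 2)) := by gcongr
      _ ≤ _ := by
        rw [one_mul]
        gcongr
        exact le_add_of_nonneg_right (by positivity)
  · obtain ⟨N, hN, hN1, hN2⟩ := ceil (a := 16) (by norm_num)
    have h1 := re_logGen_sub_le hk ht θ hN
    have hθ0 : 0 < |θ| := lt_of_lt_of_le (by positivity) h
    have h2 : c₂ * (1 / t ^ k) ≤ (N : ℝ) ^ (k - 1) * Real.exp (-(2 * N * t)) *
        ∑ μ ∈ Finset.Ico N (2 * N), (1 - Real.cos (μ * θ)) := by
      have h3 : (N : ℝ) / 2 ≤ ∑ μ ∈ Finset.Ico N (2 * N), (1 - Real.cos (μ * θ)) := by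
        have h4 := sum_cos_le hθ (abs_pos.1 hθ0) N (2 * N) (by omega)
        have h5 : π / |θ| ≤ N / 2 := by
          calc π / |θ| ≤ 4 / (t / 2) := by
                gcongr
                exact Real.pi_le_four
            _ = 16 / t / 2 := by ring
            _ ≤ N / 2 := by gcongr
        rw [Finset.sum_sub_distrib, Finset.sum_const, Nat.card_Ico, nsmul_eq_mul, mul_one,
          show 2 * N - N = N by omega]
        linarith
      have h5 : Real.exp (-34) ≤ Real.exp (-(2 * N * t)) := Real.exp_le_exp.2 (by linarith)
      have h6 : 1 / t ≤ N := le_trans (by gcongr; norm_num) hN1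
      calc c₂ * (1 / t ^ k) = (1 / t) ^ (k - 1) * Real.exp (-34) * (1 / t / 2) := by
            rw [hc₂, ← one_div_pow, ← hkk]
            ring
        _ ≤ (N : ℝ) ^ (k - 1) * Real.exp (-(2 * N * t)) * (N / 2) := by gcongr
        _ ≤ _ := by gcongr
    set Y := 1 / t ^ k with hY
    have hY0 : 0 < Y := by positivity
    have h6 : Real.exp ((logGen k (t + θ * Complex.I)).re - logGenMoment k 0 t) *
        ((c₂ * Y) ^ 3 / 6) ≤ 1 := by
      calc _ ≤ Real.exp (-(c₂ * Y)) * ((c₂ * Y) ^ 3 / 6) := by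
            gcongr
            linarith
        _ ≤ Real.exp (-(c₂ * Y)) * Real.exp (c₂ * Y) := by
            gcongr
            simpa [Nat.factorial] using
              Real.pow_div_factorial_le_exp (c₂ * Y) (by positivity) 3
        _ = 1 := by rw [← Real.exp_add]; simp
    have h7 : θ ^ 2 ≤ π ^ 2 := by
      rw [← sq_abs θ]
      gcongr
    have h8 : Real.exp ((logGen k (t + θ * Complex.I)).re - logGenMoment k 0 t) ≤
        6 / c₂ ^ 3 * t ^ (k + 2) := by
      have h9 : (t ^ k) ^ 3 ≤ t ^ (k + 2) := by
        rw [← pow_mul]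
        exact pow_le_pow_of_le_one ht.le ht1 (by omega)
      calc _ = Real.exp ((logGen k (t + θ * Complex.I)).re - logGenMoment k 0 t) *
            ((c₂ * Y) ^ 3 / 6) * (6 / c₂ ^ 3 * (t ^ k) ^ 3) := by
            rw [hY]; field_simp
        _ ≤ 1 * (6 / c₂ ^ 3 * t ^ (k + 2)) := by gcongr
        _ = _ := one_mul _
    calc _ ≤ 6 / c₂ ^ 3 * t ^ (k + 2) * π ^ 2 := by gcongr
      _ = π ^ 2 * 6 / c₂ ^ 3 * t ^ (k + 2) := by ring
      _ ≤ _ := by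
        gcongr
        exact le_add_of_nonneg_left (by positivity)

/-- Minus the derivative of the principal part of the logarithm of the generating function. -/
noncomputable def saddleFreq (k : ℕ) (t : ℝ) : ℝ :=
  ∑ h ∈ Finset.range k, principalCoeff k h * ((h : ℝ) + 1) / t ^ (h + 2)

lemma continuous_logGen_add_mul_I (k : ℕ) {t : ℝ} (ht : 0 < t) :
    Continuous fun θ : ℝ => logGen k (t + θ * Complex.I) := by
  have hre : ∀ θ : ℝ, (t + θ * Complex.I : ℂ).re = t := fun θ => by simp
  refine continuous_tsum (u := fun p : ℕ × ℕ => partWeight k p.2 / ((p.1 : ℝ) + 1) *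
    Real.exp (-(((p.2 : ℝ) + 1) * ((p.1 : ℝ) + 1) * t))) (fun p => by fun_prop) ?_ fun p θ => ?_
  · simpa using (hasSum_logGenMoment k 0 ht).1.summable
  · rw [norm_logGen_term, hre]

lemma tendsto_saddle_exponent {k : ℕ} (hk : 1 ≤ k) (u : ℝ) :
    Tendsto (fun t : ℝ => logGen k (t + (√t ^ (k + 2) * u : ℝ) * Complex.I) - logGenMoment k 0 t +
      (saddleFreq k t * (√t ^ (k + 2) * u) : ℝ) * Complex.I) (𝓝[>] 0)
      (𝓝 ((-((((k : ℝ) + 1) * (k * k.factorial * realZeta (k + 1)) / 2) * u ^ 2) : ℝ) : ℂ)) := by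
  have hsq : Tendsto (fun t : ℝ => √t) (𝓝[>] 0) (𝓝 0) := by
    have h := (Real.continuous_sqrt.tendsto 0).mono_left (nhdsWithin_le_nhds (s := Set.Ioi 0))
    simpa using h
  have hsqrt : ∀ {t : ℝ}, 0 < t → √t ^ 2 = t := fun ht => Real.sq_sqrt ht.le
  have h2 := tendsto_pow_mul_logGenMoment hk 2
  have h3 := tendsto_pow_mul_logGenMoment hk 3
  rw [show (k : ℝ) * (((k - 1 + 2).factorial : ℕ) * realZeta (k + 1)) =
    ((k : ℝ) + 1) * (k * k.factorial * realZeta (k + 1)) by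
      rw [show k - 1 + 2 = k + 1 by omega, Nat.factorial_succ]; push_cast; ring] at h2
  obtain ⟨C, hC, hb⟩ := abs_logGenMoment_one_sub_le k
  have hquad : Tendsto (fun t : ℝ => ((-((t ^ (k + 2) * logGenMoment k 2 t) / 2 * u ^ 2) : ℝ) : ℂ))
      (𝓝[>] 0) (𝓝 ((-((((k : ℝ) + 1) * (k * k.factorial * realZeta (k + 1)) / 2) * u ^ 2) : ℝ)
        : ℂ)) :=
    (Complex.continuous_ofReal.tendsto _).comp ((h2.div_const 2).mul_const (u ^ 2)).neg
  have hlin : Tendsto (fun t : ℝ => |u| * (√t ^ (k + 2) * (C * t ^ (-(5 / 4) : ℝ))))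
      (𝓝[>] 0) (𝓝 0) := by
    have h4 : Tendsto (fun t : ℝ => C * |u| * √t ^ (k - 1) * t ^ (1 / 4 : ℝ)) (𝓝[>] 0) (𝓝 0) := by
      have h5 : Tendsto (fun t : ℝ => t ^ (1 / 4 : ℝ)) (𝓝[>] 0) (𝓝 0) := by
        have h := (Real.continuousAt_rpow_const 0 (1 / 4 : ℝ) (Or.inr (by norm_num))).tendsto
        rw [Real.zero_rpow (by norm_num)] at h
        exact h.mono_left nhdsWithin_le_nhds
      simpa using ((hsq.pow (k - 1)).const_mul (C * |u|)).mul h5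
    refine h4.congr' ?_
    filter_upwards [self_mem_nhdsWithin] with t (ht : 0 < t)
    have h6 : √t ^ (k + 2) = √t ^ (k - 1) * t ^ (3 / 2 : ℝ) := by
      rw [show k + 2 = k - 1 + 3 by omega, pow_add]
      congr 1
      rw [Real.sqrt_eq_rpow, ← Real.rpow_natCast, ← Real.rpow_mul ht.le]
      norm_num
    have h7 : t ^ (1 / 4 : ℝ) = t ^ (3 / 2 : ℝ) * t ^ (-(5 / 4) : ℝ) := by
      rw [← Real.rpow_add ht]; norm_num
    rw [h6, h7]
    ring
  have hcub : Tendsto (fun t : ℝ => 4 * |u| ^ 3 * √t ^ k * (t ^ (k + 3) * logGenMoment k 3 t))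
      (𝓝[>] 0) (𝓝 0) := by
    have h := ((hsq.pow k).const_mul (4 * |u| ^ 3)).mul h3
    rw [zero_pow (by omega)] at h
    simpa using h
  have herr := hlin.add hcub
  rw [add_zero] at herr
  have hdiff : Tendsto (fun t : ℝ => logGen k (t + (√t ^ (k + 2) * u : ℝ) * Complex.I) -
      logGenMoment k 0 t + (saddleFreq k t * (√t ^ (k + 2) * u) : ℝ) * Complex.I -
      ((-((t ^ (k + 2) * logGenMoment k 2 t) / 2 * u ^ 2) : ℝ) : ℂ)) (𝓝[>] 0) (𝓝 0) := by
    refine squeeze_zero_norm' ?_ herr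
    filter_upwards [self_mem_nhdsWithin] with t (ht : 0 < t)
    set s := √t ^ (k + 2) with hs
    have hs0 : 0 < s := by have := Real.sqrt_pos.2 ht; positivity
    have hs2 : s ^ 2 = t ^ (k + 2) := by rw [hs, ← pow_mul, mul_comm, pow_mul, hsqrt ht]
    have h4 := norm_logGen_add_mul_I_sub_le k ht (s * u)
    have h5 : logGen k (t + (s * u : ℝ) * Complex.I) - logGenMoment k 0 t +
        (saddleFreq k t * (s * u) : ℝ) * Complex.I -
        ((-((t ^ (k + 2) * logGenMoment k 2 t) / 2 * u ^ 2) : ℝ) : ℂ) =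
        -(((s * u) * (logGenMoment k 1 t - saddleFreq k t) : ℝ) * Complex.I) +
        (logGen k (t + (s * u : ℝ) * Complex.I) - logGenMoment k 0 t -
        (-((s * u : ℝ) * logGenMoment k 1 t * Complex.I) -
          (s * u : ℝ) ^ 2 / 2 * logGenMoment k 2 t)) := by
      rw [← hs2]
      push_cast
      ring
    rw [h5]
    refine (norm_add_le _ _).trans <| add_le_add ?_ (h4.trans (le_of_eq ?_))
    · rw [norm_neg, norm_mul, Complex.norm_I, mul_one, Complex.norm_real, Real.norm_eq_abs,
        abs_mul, abs_mul, abs_of_pos hs0]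
      have h6 : |logGenMoment k 1 t - saddleFreq k t| ≤ C * t ^ (-(5 / 4) : ℝ) := hb t ht
      calc s * |u| * |logGenMoment k 1 t - saddleFreq k t| ≤ s * |u| * (C * t ^ (-(5 / 4) : ℝ)) := by
            gcongr
        _ = _ := by ring
    · have h7 : s ^ 3 = √t ^ k * t ^ (k + 3) := by
        have h8 : s ^ 3 = s * s ^ 2 := by ring
        rw [h8, hs2, hs, pow_add, hsqrt ht]
        ring
      rw [abs_mul, abs_of_pos hs0, mul_pow, h7]
      ring
  simpa using hdiff.add hquad

lemma tendsto_saddle_integral {k : ℕ} (hk : 1 ≤ k) (hζ : 0 < realZeta (k + 1)) :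
    Tendsto (fun t : ℝ => ∫ u in (-(π / √t ^ (k + 2)))..(π / √t ^ (k + 2)),
      Complex.exp (logGen k (t + (√t ^ (k + 2) * u : ℝ) * Complex.I) - logGenMoment k 0 t +
        (saddleFreq k t * (√t ^ (k + 2) * u) : ℝ) * Complex.I)) (𝓝[>] 0)
      (𝓝 ((√(2 * π / (((k : ℝ) + 1) * (k * k.factorial * realZeta (k + 1)))) : ℝ) : ℂ)) := by
  set B : ℝ := ((k : ℝ) + 1) * (k * k.factorial * realZeta (k + 1)) with hB
  have hπ := Real.pi_pos
  have hB0 : 0 < B := by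
    have : (0 : ℝ) < k := by exact_mod_cast hk
    positivity
  obtain ⟨C, hC, hdom⟩ := exists_exp_re_logGen_sub_le hk
  set Φ : ℝ → ℝ → ℂ := fun t u => Complex.exp (logGen k (t + (√t ^ (k + 2) * u : ℝ) * Complex.I) -
    logGenMoment k 0 t + (saddleFreq k t * (√t ^ (k + 2) * u) : ℝ) * Complex.I) with hΦ
  set I : ℝ → Set ℝ := fun t => Set.Ioc (-(π / √t ^ (k + 2))) (π / √t ^ (k + 2)) with hI
  have hgauss : ∫ u : ℝ, ((Real.exp (-((B / 2) * u ^ 2)) : ℝ) : ℂ) = ((√(2 * π / B) : ℝ) : ℂ) := by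
    rw [integral_complex_ofReal]
    have := integral_gaussian (B / 2)
    simp only [neg_mul] at this
    rw [this]
    congr 2
    field_simp
  have hmain : Tendsto (fun t => ∫ u, (I t).indicator (Φ t) u) (𝓝[>] 0)
      (𝓝 (∫ u : ℝ, ((Real.exp (-((B / 2) * u ^ 2)) : ℝ) : ℂ))) := by
    refine MeasureTheory.tendsto_integral_filter_of_dominated_convergence
      (fun u => (1 + C) * (1 + u ^ 2)⁻¹) ?_ ?_ (integrable_inv_one_add_sq.const_mul _) ?_
    · filter_upwards [self_mem_nhdsWithin] with t (ht : 0 < t)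
      refine (Continuous.aestronglyMeasurable ?_).indicator measurableSet_Ioc
      have h1 := (continuous_logGen_add_mul_I k ht).comp
        (continuous_const_mul (√t ^ (k + 2)))
      exact Complex.continuous_exp.comp
        ((h1.sub continuous_const).add (by fun_prop))
    · filter_upwards [self_mem_nhdsWithin, Ioo_mem_nhdsGT (zero_lt_one' ℝ)] with t (ht : 0 < t) ht1
      refine Eventually.of_forall fun u => ?_
      have hs0 : 0 < √t ^ (k + 2) := by have := Real.sqrt_pos.2 ht; positivity
      have hs2 : (√t ^ (k + 2)) ^ 2 = t ^ (k + 2) := by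
        rw [← pow_mul, mul_comm, pow_mul, Real.sq_sqrt ht.le]
      by_cases hu : u ∈ I t
      · rw [Set.indicator_of_mem hu]
        have hθ : |√t ^ (k + 2) * u| ≤ π := by
          rw [abs_mul, abs_of_pos hs0, ← le_div_iff₀' hs0]
          exact abs_le.2 ⟨hu.1.le, hu.2⟩
        obtain ⟨h1, h2⟩ := hdom t ht ht1.2.le _ hθ
        set E := Real.exp ((logGen k (t + (√t ^ (k + 2) * u : ℝ) * Complex.I)).re -
          logGenMoment k 0 t) with hE
        have h3 : ‖Φ t u‖ = E := by
          rw [hΦ, hE, Complex.norm_exp, Complex.add_re, Complex.sub_re, Complex.re_ofReal_mul,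
            Complex.I_re, Complex.ofReal_re, mul_zero, add_zero]
        rw [h3, ← div_eq_mul_inv, le_div_iff₀ (by positivity)]
        have h4 : E * u ^ 2 ≤ C := by
          rw [mul_pow, hs2] at h2
          have h5 : 0 < t ^ (k + 2) := by positivity
          refine le_of_mul_le_mul_right ?_ h5
          linarith
        linarith
      · rw [Set.indicator_of_notMem hu, norm_zero]
        positivity
    · refine Eventually.of_forall fun u => ?_
      have h1 := (Complex.continuous_exp.tendsto _).comp (tendsto_saddle_exponent hk u)
      rw [← Complex.ofReal_exp] at h1
      refine h1.congr' ?_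
      have h2 : Tendsto (fun t : ℝ => √t ^ (k + 2) * |u|) (𝓝[>] 0) (𝓝 0) := by
        have h : Continuous fun t : ℝ => √t ^ (k + 2) * |u| := by fun_prop
        have h3 := (h.tendsto 0).mono_left (nhdsWithin_le_nhds (s := Set.Ioi 0))
        simpa using h3
      filter_upwards [self_mem_nhdsWithin, h2.eventually_lt_const hπ] with t (ht : 0 < t) hu
      have hs0 : 0 < √t ^ (k + 2) := by have := Real.sqrt_pos.2 ht; positivity
      rw [← lt_div_iff₀' hs0, abs_lt] at hu
      rw [Set.indicator_of_mem (show u ∈ I t from ⟨hu.1, hu.2.le⟩)]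
      rfl
  rw [hgauss] at hmain
  refine hmain.congr' ?_
  filter_upwards [self_mem_nhdsWithin] with t (ht : 0 < t)
  have hs0 : 0 < √t ^ (k + 2) := by have := Real.sqrt_pos.2 ht; positivity
  rw [MeasureTheory.integral_indicator measurableSet_Ioc,
    intervalIntegral.integral_of_le (by linarith [div_pos hπ hs0])]

lemma pk_eq_saddle_integral {k : ℕ} (hk : 1 ≤ k) {t : ℝ} (ht : 0 < t) {n : ℕ}
    (hn : (n : ℝ) = saddleFreq k t) :
    (pk (1 / (k : ℝ)) n : ℂ) = ((Real.exp (logGenMoment k 0 t + n * t) * √t ^ (k + 2) /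
      (2 * π) : ℝ) : ℂ) * ∫ u in (-(π / √t ^ (k + 2)))..(π / √t ^ (k + 2)),
      Complex.exp (logGen k (t + (√t ^ (k + 2) * u : ℝ) * Complex.I) - logGenMoment k 0 t +
        (saddleFreq k t * (√t ^ (k + 2) * u) : ℝ) * Complex.I) := by
  have hs0 : 0 < √t ^ (k + 2) := by have := Real.sqrt_pos.2 ht; positivity
  have h1 := intervalIntegral.integral_comp_mul_left (a := -(π / √t ^ (k + 2)))
    (b := π / √t ^ (k + 2)) (fun θ : ℝ => Complex.exp (logGen k (t + θ * Complex.I) +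
      n * (t + θ * Complex.I))) hs0.ne'
  rw [mul_neg, mul_div_cancel₀ _ hs0.ne', integral_exp_logGen hk ht] at h1
  have h2 : ∀ u : ℝ, Complex.exp (logGen k (t + (√t ^ (k + 2) * u : ℝ) * Complex.I) +
      n * (t + (√t ^ (k + 2) * u : ℝ) * Complex.I)) =
      ((Real.exp (logGenMoment k 0 t + n * t) : ℝ) : ℂ) *
      Complex.exp (logGen k (t + (√t ^ (k + 2) * u : ℝ) * Complex.I) - logGenMoment k 0 t +
        (saddleFreq k t * (√t ^ (k + 2) * u) : ℝ) * Complex.I) := fun u => by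
    rw [← hn, Complex.ofReal_exp, ← Complex.exp_add]
    congr 1
    push_cast
    ring
  simp only [h2] at h1
  rw [intervalIntegral.integral_const_mul] at h1
  generalize (∫ u in (-(π / √t ^ (k + 2)))..(π / √t ^ (k + 2)),
      Complex.exp (logGen k (t + (√t ^ (k + 2) * u : ℝ) * Complex.I) - logGenMoment k 0 t +
        (saddleFreq k t * (√t ^ (k + 2) * u) : ℝ) * Complex.I)) = X at h1 ⊢
  have h3 : ((√t ^ (k + 2) : ℝ) : ℂ) ≠ 0 := by exact_mod_cast hs0.ne'
  have hπ : (π : ℂ) ≠ 0 := by exact_mod_cast Real.pi_pos.ne'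
  rw [Complex.real_smul, Complex.ofReal_inv, eq_inv_mul_iff_mul_eq₀ h3] at h1
  push_cast at h1 ⊢
  field_simp
  linear_combination -h1

lemma exists_analyticAt_saddle {m : ℕ} (hm : m ≠ 0) {Q : ℝ → ℝ} (hQ : AnalyticAt ℝ Q 0)
    (hQ0 : 0 < Q 0) : ∃ v : ℝ → ℝ, AnalyticAt ℝ v 0 ∧ v 0 = 1 ∧
      ∀ᶠ x in 𝓝[>] (0 : ℝ), 0 < v x ∧ Q 0 / x ^ m = Q (x * v x) / (x * v x) ^ m := by
  set e : ℝ → ℝ := fun t => Real.exp ((Real.log (Q 0) - Real.log (Q t)) / m) with he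
  have hea : AnalyticAt ℝ e 0 :=
    ((analyticAt_const.sub (hQ.log hQ0)).div analyticAt_const (by exact_mod_cast hm)).rexp'
  have he0 : e 0 = 1 := by simp [he]
  set ψ : ℝ → ℝ := fun t => t * e t with hψ
  have hψa : AnalyticAt ℝ ψ 0 := analyticAt_id.mul hea
  have hψ0 : ψ 0 = 0 := zero_mul _
  have hψd : deriv ψ 0 = 1 := by
    have h := (hasDerivAt_id (0 : ℝ)).fun_mul hea.differentiableAt.hasDerivAt
    rw [he0] at h
    simpa using h.deriv
  have hne : deriv ψ 0 ≠ 0 := by rw [hψd]; exact one_ne_zero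
  set τ := hψa.hasStrictDerivAt.localInverse _ _ _ hne with hτ
  have hτa : AnalyticAt ℝ τ 0 := by
    have h := hψa.analyticAt_localInverse hne
    rwa [hψ0] at h
  have hτ0 : τ 0 = 0 := by
    have h : τ (ψ 0) = 0 := HasStrictFDerivAt.localInverse_apply_image ..
    rwa [hψ0] at h
  have hτd : deriv τ 0 = 1 := by
    have h := (hψa.hasStrictDerivAt.to_localInverse hne).hasDerivAt
    rw [hψ0] at h
    rw [h.deriv, hψd, inv_one]
  have hinv : ∀ᶠ x in 𝓝 0, ψ (τ x) = x := by
    have h := HasStrictDerivAt.eventually_right_inverse hψa.hasStrictDerivAt hne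
    rwa [hψ0] at h
  have hva := hτa.dslope_self
  have hv0 : dslope τ 0 0 = 1 := by rw [dslope_same, hτd]
  have hxv : ∀ x, x * dslope τ 0 x = τ x := fun x => by
    simpa [hτ0] using sub_smul_dslope τ 0 x
  have hQτ : ∀ᶠ x in 𝓝 0, 0 < Q (τ x) := by
    have h : Tendsto (fun x => Q (τ x)) (𝓝 0) (𝓝 (Q 0)) := by
      have h1 := hQ.continuousAt
      rw [← hτ0] at h1
      have h2 := (ContinuousAt.comp h1 hτa.continuousAt).tendsto
      simpa only [Function.comp_def, hτ0] using h2
    exact h.eventually_const_lt hQ0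
  have hvpos : ∀ᶠ x in 𝓝 0, 0 < dslope τ 0 x :=
    hva.continuousAt.eventually_const_lt (by rw [hv0]; exact one_pos)
  refine ⟨dslope τ 0, hva, hv0, ?_⟩
  filter_upwards [self_mem_nhdsWithin, nhdsWithin_le_nhds hinv, nhdsWithin_le_nhds hQτ,
    nhdsWithin_le_nhds hvpos] with x (hx : 0 < x) h1 h2 h3
  refine ⟨h3, ?_⟩
  have h4 : e (τ x) ^ m = Q 0 / Q (τ x) := by
    rw [he]
    dsimp only
    rw [← Real.exp_nat_mul, mul_div_cancel₀ _ (by exact_mod_cast hm), Real.exp_sub,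
      Real.exp_log hQ0, Real.exp_log h2]
  have h5 : τ x ^ m * (Q 0 / Q (τ x)) = x ^ m := by
    rw [← h4, ← mul_pow]
    exact congrArg (· ^ m) h1
  rw [hxv, ← h5]
  have h6 : 0 < τ x := by rw [← hxv]; positivity
  field_simp

lemma HasFPowerSeriesAt.tendsto_div_pow_sub_sum {H : ℝ → ℝ} {p : FormalMultilinearSeries ℝ ℝ ℝ}
    (hp : HasFPowerSeriesAt H p 0) (k : ℕ) :
    Tendsto (fun x => H x / x ^ k - ∑ h ∈ Finset.range (k + 1), p.coeff h / x ^ (k - h))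
      (𝓝[>] 0) (𝓝 0) := by
  have h1 := (hp.isBigO_sub_partialSum_pow (k + 1)).mono (nhdsWithin_le_nhds (s := Set.Ioi 0))
  obtain ⟨C, hC⟩ := h1.bound
  have h2 : Tendsto (fun x : ℝ => C * x) (𝓝[>] 0) (𝓝 0) := by
    have h : Continuous fun x : ℝ => C * x := by fun_prop
    simpa using (h.tendsto 0).mono_left (nhdsWithin_le_nhds (s := Set.Ioi 0))
  refine squeeze_zero_norm' ?_ h2
  filter_upwards [hC, self_mem_nhdsWithin] with x hx (hx0 : 0 < x)
  have h3 : H x / x ^ k - ∑ h ∈ Finset.range (k + 1), p.coeff h / x ^ (k - h) =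
      (H (0 + x) - p.partialSum (k + 1) x) / x ^ k := by
    rw [zero_add, sub_div, FormalMultilinearSeries.partialSum, Finset.sum_div]
    congr 1
    refine Finset.sum_congr rfl fun h hh => ?_
    rw [FormalMultilinearSeries.apply_eq_pow_smul_coeff, smul_eq_mul,
      ← Nat.sub_add_cancel (Nat.lt_succ_iff.1 (Finset.mem_range.1 hh)), pow_add,
      Nat.add_sub_cancel]
    field_simp
  rw [h3, norm_div, norm_pow, Real.norm_of_nonneg hx0.le, div_le_iff₀ (by positivity)]
  refine hx.trans (le_of_eq ?_)
  rw [Real.norm_of_nonneg hx0.le, Real.norm_of_nonneg (by positivity)]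
  ring

lemma principalCoeff_pred {k : ℕ} (hk : 1 ≤ k) :
    principalCoeff k (k - 1) = k.factorial * realZeta (k + 1) := by
  obtain ⟨m, rfl⟩ := Nat.exists_eq_add_of_le' hk
  rw [principalCoeff, Nat.add_sub_cancel, Nat.choose_succ_self_right, Nat.factorial_succ]
  push_cast
  rw [show (m : ℝ) + 1 + 1 = m + 2 by ring]
  ring

lemma principalCoeff_pred_pred {k : ℕ} (hk : 2 ≤ k) :
    principalCoeff k (k - 2) = k.factorial * realZeta k / 2 := by
  obtain ⟨m, rfl⟩ := Nat.exists_eq_add_of_le' hk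
  have h1 : ((m + 2).choose m : ℝ) * m.factorial * 2 = (m + 2).factorial := by
    have h := Nat.choose_mul_factorial_mul_factorial (Nat.le_add_right m 2)
    rw [Nat.add_sub_cancel_left, Nat.factorial_two] at h
    exact_mod_cast h
  rw [principalCoeff, Nat.add_sub_cancel, ← h1]
  push_cast
  ring

/-- The value of `x^k (n t + P(t))` at `t = x v` and `n = b / x^(k+1)`, where `P` is the principal
part of the logarithm of the generating function. -/
noncomputable def saddlePhase (k : ℕ) (b : ℝ) (v : ℝ → ℝ) (x : ℝ) : ℝ :=
  b * v x + ∑ h ∈ Finset.range k, principalCoeff k h * (x ^ (k - 1 - h) * (v x ^ (h + 1))⁻¹)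

lemma saddlePhase_div_pow (k : ℕ) (b : ℝ) {v : ℝ → ℝ} {x : ℝ} (hx : 0 < x) :
    saddlePhase k b v x / x ^ k = b / x ^ (k + 1) * (x * v x) +
      ∑ h ∈ Finset.range k, principalCoeff k h / (x * v x) ^ (h + 1) := by
  rw [saddlePhase, add_div, Finset.sum_div]
  congr 1
  · rw [pow_succ]
    field_simp
  · refine Finset.sum_congr rfl fun h hh => ?_
    have h1 : x ^ k = x ^ (k - 1 - h) * x ^ (h + 1) := by
      rw [← pow_add]
      congr 1
      have := Finset.mem_range.1 hh
      omega
    rw [h1, mul_pow]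
    field_simp

lemma saddlePhase_zero {k : ℕ} (hk : 1 ≤ k) (b : ℝ) {v : ℝ → ℝ} (hv0 : v 0 = 1) :
    saddlePhase k b v 0 = b + k.factorial * realZeta (k + 1) := by
  rw [saddlePhase, Finset.sum_eq_single_of_mem (k - 1) (Finset.mem_range.2 (by omega)), hv0,
    principalCoeff_pred hk]
  · simp
  · intro h hh hne
    have := Finset.mem_range.1 hh
    rw [zero_pow (by omega)]
    simp

lemma analyticAt_saddlePhase (k : ℕ) (b : ℝ) {v : ℝ → ℝ} (hv : AnalyticAt ℝ v 0)
    (hv0 : v 0 = 1) : AnalyticAt ℝ (saddlePhase k b v) 0 := by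
  refine (analyticAt_const.mul hv).add (Finset.analyticAt_fun_sum _ fun h _ => ?_)
  exact analyticAt_const.mul ((analyticAt_id.pow _).mul ((hv.pow _).inv (by simp [hv0])))

lemma deriv_saddlePhase {k : ℕ} (hk : 1 ≤ k) {v : ℝ → ℝ} (hv : AnalyticAt ℝ v 0)
    (hv0 : v 0 = 1) :
    deriv (saddlePhase k (k * k.factorial * realZeta (k + 1)) v) 0 =
      if 1 < k then k.factorial * realZeta k / 2 else 0 := by
  set d := deriv v 0 with hd
  have hvd : HasDerivAt v d 0 := hv.differentiableAt.hasDerivAt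
  have hterm : ∀ h, HasDerivAt (fun x => principalCoeff k h *
      (x ^ (k - 1 - h) * (v x ^ (h + 1))⁻¹)) (principalCoeff k h *
      (((k - 1 - h : ℕ) : ℝ) * 0 ^ (k - 1 - h - 1) - 0 ^ (k - 1 - h) * ((h + 1) * d))) 0 :=
    fun h => by
    have h1 := ((hasDerivAt_pow (k - 1 - h) (0 : ℝ)).fun_mul
      ((hvd.fun_pow (h + 1)).fun_inv (by simp [hv0]))).const_mul (principalCoeff k h)
    refine h1.congr_deriv ?_
    rw [hv0]
    simp only [one_pow, inv_one, div_one, mul_one]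
    push_cast
    ring
  have hsum := (hvd.const_mul (k * k.factorial * realZeta (k + 1))).fun_add
    (HasDerivAt.fun_sum fun h (_ : h ∈ Finset.range k) => hterm h)
  refine hsum.deriv.trans ?_
  obtain ⟨m, rfl⟩ := Nat.exists_eq_add_of_le' hk
  have hp := principalCoeff_pred hk
  rw [Nat.add_sub_cancel] at hp
  rw [Finset.sum_range_succ, hp]
  rcases m with _ | m
  · simp
  · have hp2 := principalCoeff_pred_pred (k := m + 1 + 1) (by omega)
    rw [show m + 1 + 1 - 2 = m by omega] at hp2
    rw [Finset.sum_range_succ, hp2, Finset.sum_eq_zero, if_pos (by omega)]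
    · simp
      ring
    · intro h hh
      have := Finset.mem_range.1 hh
      rw [zero_pow (by omega), zero_pow (by omega)]
      ring

lemma exists_saddle_scale {k : ℕ} (hk : 1 ≤ k)
    (hζ : 0 < realZeta (k + 1)) :
    ∃ v : ℝ → ℝ, AnalyticAt ℝ v 0 ∧ v 0 = 1 ∧ ∀ᶠ x in 𝓝[>] 0, 0 < v x ∧
      k * k.factorial * realZeta (k + 1) / x ^ (k + 1) = saddleFreq k (x * v x) := by
  set Q : ℝ → ℝ := fun t => ∑ h ∈ Finset.range k,
    principalCoeff k h * ((h : ℝ) + 1) * t ^ (k - 1 - h) with hQdef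
  have hQ : AnalyticAt ℝ Q 0 :=
    Finset.analyticAt_fun_sum _ fun h _ => analyticAt_const.mul (analyticAt_id.pow _)
  have hQ0 : Q 0 = k * k.factorial * realZeta (k + 1) := by
    rw [hQdef]
    dsimp only
    rw [Finset.sum_eq_single_of_mem (k - 1) (Finset.mem_range.2 (by omega)),
      principalCoeff_pred hk, Nat.cast_sub hk]
    · simp
      ring
    · intro h hh hne
      have := Finset.mem_range.1 hh
      rw [zero_pow (by omega), mul_zero]
  have hk0 : (0 : ℝ) < k := by exact_mod_cast hk
  have hQpos : 0 < Q 0 := by rw [hQ0]; positivity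
  obtain ⟨v, hv, hv0, hev⟩ := exists_analyticAt_saddle (Nat.succ_ne_zero k) hQ hQpos
  refine ⟨v, hv, hv0, ?_⟩
  filter_upwards [hev, self_mem_nhdsWithin] with x hx hx0
  refine ⟨hx.1, ?_⟩
  rw [← hQ0, hx.2]
  have ht : 0 < x * v x := mul_pos hx0 hx.1
  rw [hQdef, saddleFreq, Finset.sum_div]
  refine Finset.sum_congr rfl fun h hh => ?_
  have h1 : (x * v x) ^ (k + 1) = (x * v x) ^ (k - 1 - h) * (x * v x) ^ (h + 2) := by
    rw [← pow_add]
    congr 1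
    have := Finset.mem_range.1 hh
    omega
  rw [h1]
  field_simp

lemma realZeta_add_one_pos {k : ℕ} (hk : 1 ≤ k) : 0 < realZeta (k + 1) := by
  have h := realZeta_natCast (n := k + 1) (by omega)
  push_cast at h
  rw [← h.tsum_eq]
  exact h.summable.tsum_pos (fun j => by positivity) 0 (by positivity)

lemma pk_eq_exp_mul_norm {k : ℕ} (hk : 1 ≤ k) {n : ℕ} {t : ℝ} (ht : 0 < t)
    (hn : (n : ℝ) = saddleFreq k t) :
    (pk (1 / (k : ℝ)) n : ℝ) = Real.exp (logGenMoment k 0 t + n * t) * √t ^ (k + 2) / (2 * π) *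
      ‖∫ u in (-(π / √t ^ (k + 2)))..(π / √t ^ (k + 2)),
        Complex.exp (logGen k (t + (√t ^ (k + 2) * u : ℝ) * Complex.I) - logGenMoment k 0 t +
          (saddleFreq k t * (√t ^ (k + 2) * u) : ℝ) * Complex.I)‖ := by
  have h := congrArg norm (pk_eq_saddle_integral hk ht hn)
  rwa [norm_mul, Complex.norm_natCast, Complex.norm_real, Real.norm_of_nonneg (by positivity)] at h

/-- The scale `x = (b / n)^(1/(k+1))` tends to `0` from the right. -/
lemma tendsto_rpow_div_natCast {k : ℕ} {b : ℝ} (hb : 0 < b) :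
    Tendsto (fun n : ℕ => (b / (n : ℝ)) ^ (1 / ((k : ℝ) + 1))) atTop (𝓝[>] 0) := by
  refine tendsto_nhdsWithin_iff.2 ⟨?_, ?_⟩
  · have h := (tendsto_const_div_atTop_nhds_zero_nat b).rpow_const
      (p := 1 / ((k : ℝ) + 1)) (Or.inr (by positivity))
    rwa [Real.zero_rpow (by positivity)] at h
  · filter_upwards [eventually_gt_atTop 0] with n hn
    have : (0 : ℝ) < n := by exact_mod_cast hn
    exact Real.rpow_pos_of_pos (div_pos hb this) _

/-- The saddle point asymptotic, in terms of a continuous scale. -/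
lemma tendsto_pk_scaled {k : ℕ} (hk : 1 ≤ k) {b A : ℝ}
    (hb : b = k * k.factorial * realZeta (k + 1))
    (hA : A = ∑ h ∈ Finset.range k, (k.choose h : ℝ) * realZetaDeriv (-(h : ℝ)))
    {v : ℝ → ℝ} (hv : AnalyticAt ℝ v 0) (hv0 : v 0 = 1)
    (hev : ∀ᶠ x in 𝓝[>] 0, 0 < v x ∧ b / x ^ (k + 1) = saddleFreq k (x * v x))
    {p : FormalMultilinearSeries ℝ ℝ ℝ} (hp : HasFPowerSeriesAt (saddlePhase k b v) p 0) :
    Tendsto (fun x : ℝ => Real.exp (logGenMoment k 0 (x * v x) + b / x ^ (k + 1) * (x * v x)) *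
        √(x * v x) ^ (k + 2) / (2 * π) *
      ‖∫ u in (-(π / √(x * v x) ^ (k + 2)))..(π / √(x * v x) ^ (k + 2)),
        Complex.exp (logGen k ((x * v x : ℝ) + (√(x * v x) ^ (k + 2) * u : ℝ) * Complex.I) -
          logGenMoment k 0 (x * v x) +
          (saddleFreq k (x * v x) * (√(x * v x) ^ (k + 2) * u) : ℝ) * Complex.I)‖ /
      (Real.exp A / √(2 * π * b * ((k : ℝ) + 1)) * (x ^ ((k : ℝ) / (k + 1)) * √x ^ (k + 2)) *
        Real.exp (∑ h ∈ Finset.range (k + 1), p.coeff h / x ^ (k - h)))) (𝓝[>] 0) (𝓝 1) := by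
  have hζ := realZeta_add_one_pos hk
  have hk0 : (0 : ℝ) < k := by exact_mod_cast hk
  have hbpos : 0 < b := by rw [hb]; positivity
  have hv1 : Tendsto v (𝓝[>] 0) (𝓝 1) := by
    have h := hv.continuousAt.tendsto
    rw [hv0] at h
    exact h.mono_left nhdsWithin_le_nhds
  have ht : Tendsto (fun x : ℝ => x * v x) (𝓝[>] 0) (𝓝[>] 0) := by
    refine tendsto_nhdsWithin_iff.2 ⟨?_, ?_⟩
    · have h0 : Tendsto (fun x : ℝ => x) (𝓝[>] 0) (𝓝 0) := tendsto_id.mono_left nhdsWithin_le_nhds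
      simpa using h0.mul hv1
    · filter_upwards [hev, self_mem_nhdsWithin] with x hx hx0 using mul_pos hx0 hx.1
  have h1 := (((tendsto_logGenMoment_zero k).comp ht).sub_const A).rexp
  rw [← hA, sub_self, Real.exp_zero] at h1
  have h2 := (hp.tendsto_div_pow_sub_sum k).rexp
  rw [Real.exp_zero] at h2
  have h3 : Tendsto (fun x => v x ^ ((k : ℝ) / (k + 1)) * √(v x) ^ (k + 2)) (𝓝[>] 0) (𝓝 1) := by
    have ha := hv1.rpow_const (p := (k : ℝ) / (k + 1)) (Or.inl one_ne_zero)
    have hc := (hv1.sqrt).pow (k + 2)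
    have h := ha.mul hc
    rwa [Real.one_rpow, Real.sqrt_one, one_pow, mul_one] at h
  have h4 := (((tendsto_saddle_integral hk hζ).comp ht).norm).mul_const
    (√(2 * π * b * ((k : ℝ) + 1)) / (2 * π))
  rw [Complex.norm_real, Real.norm_of_nonneg (Real.sqrt_nonneg _), ← hb] at h4
  have hconst : √(2 * π / (((k : ℝ) + 1) * b)) * (√(2 * π * b * ((k : ℝ) + 1)) / (2 * π)) = 1 := by
    rw [← mul_div_assoc, ← Real.sqrt_mul (by positivity),
      show 2 * π / (((k : ℝ) + 1) * b) * (2 * π * b * ((k : ℝ) + 1)) = (2 * π) ^ 2 by field_simp,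
      Real.sqrt_sq (by positivity), div_self (by positivity)]
  rw [hconst] at h4
  have h := ((h1.mul h2).mul h3).mul h4
  rw [mul_one, mul_one, mul_one] at h
  refine h.congr' ?_
  filter_upwards [hev, self_mem_nhdsWithin] with x hx hx0
  have hx0 : 0 < x := hx0
  have hvx := hx.1
  have hlog : Real.exp ((k : ℝ) / (k + 1) * Real.log (x * v x)) =
      x ^ ((k : ℝ) / (k + 1)) * v x ^ ((k : ℝ) / (k + 1)) := by
    rw [← Real.mul_rpow hx0.le hvx.le, Real.rpow_def_of_pos (mul_pos hx0 hvx), mul_comm]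
  dsimp only [Function.comp_apply]
  generalize ‖∫ u in (-(π / √(x * v x) ^ (k + 2)))..(π / √(x * v x) ^ (k + 2)),
        Complex.exp (logGen k ((x * v x : ℝ) + (√(x * v x) ^ (k + 2) * u : ℝ) * Complex.I) -
          logGenMoment k 0 (x * v x) +
          (saddleFreq k (x * v x) * (√(x * v x) ^ (k + 2) * u) : ℝ) * Complex.I)‖ = N
  rw [saddlePhase_div_pow k b hx0, Real.sqrt_mul hx0.le, mul_pow, Real.exp_sub, Real.exp_sub,
    Real.exp_sub, Real.exp_sub, hlog, Real.exp_add, Real.exp_add]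
  have hs : 0 < √(2 * π * b * ((k : ℝ) + 1)) := Real.sqrt_pos.2 (by positivity)
  have hsx : 0 < √x := Real.sqrt_pos.2 hx0
  have hsv : 0 < √(v x) := Real.sqrt_pos.2 hvx
  have hxp : 0 < x ^ ((k : ℝ) / (k + 1)) := Real.rpow_pos_of_pos hx0 _
  have hvp : 0 < v x ^ ((k : ℝ) / (k + 1)) := Real.rpow_pos_of_pos hvx _
  generalize x ^ ((k : ℝ) / (k + 1)) = X at *
  generalize v x ^ ((k : ℝ) / (k + 1)) = V at *
  generalize √(2 * π * b * ((k : ℝ) + 1)) = S at *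
  generalize √x = sx at *
  generalize √(v x) = sv at *
  generalize Real.exp (logGenMoment k 0 (x * v x)) = E at *
  generalize Real.exp (b / x ^ (k + 1) * (x * v x)) = F at *
  have hP := Real.exp_pos (∑ h ∈ Finset.range k, principalCoeff k h / (x * v x) ^ (h + 1))
  have hL := Real.exp_pos (∑ h ∈ Finset.range (k + 1), p.coeff h / x ^ (k - h))
  generalize Real.exp (∑ h ∈ Finset.range k, principalCoeff k h / (x * v x) ^ (h + 1)) = P at *
  generalize Real.exp (∑ h ∈ Finset.range (k + 1), p.coeff h / x ^ (k - h)) = L at *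
  field_simp

theorem stmt1 (k : ℕ) (hk : 1 ≤ k) (β δ A : ℝ)
    (hβ : β = (k : ℝ) * (Nat.factorial k : ℝ) * realZeta ((k : ℝ) + 1))
    (hδ : δ = 1 / 2 + (1 / 2 + (k : ℝ) / ((k : ℝ) + 1)) / ((k : ℝ) + 1))
    (hA : A = ∑ h ∈ Finset.range k, (Nat.choose k h : ℝ) * realZetaDeriv (-(h : ℝ))) :
    ∃ lam : ℕ → ℝ,
      lam 0 = (1 + 1 / (k : ℝ)) * β ∧
      lam 1 = (if 1 < k then (Nat.factorial k : ℝ) * realZeta (k : ℝ) / 2 else 0) ∧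
      Tendsto (fun n : ℕ => (pk (1 / (k : ℝ)) n : ℝ) /
          ((Real.exp A / Real.sqrt (2 * π * β * ((k : ℝ) + 1))) * (β / (n : ℝ)) ^ δ *
            Real.exp (∑ h ∈ Finset.range (k + 1),
              lam h * ((n : ℝ) / β) ^ (((k : ℝ) - (h : ℝ)) / ((k : ℝ) + 1)))))
        atTop (𝓝 1) := by
  have hζ := realZeta_add_one_pos hk
  have hk0 : (0 : ℝ) < k := by exact_mod_cast hk
  have hβpos : 0 < β := by rw [hβ]; positivity
  obtain ⟨v, hv, hv0, hev⟩ := exists_saddle_scale hk hζ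
  rw [← hβ] at hev
  obtain ⟨p, hp⟩ := analyticAt_saddlePhase k β hv hv0
  refine ⟨p.coeff, ?_, ?_, ?_⟩
  · have h := hp.coeff_zero (fun _ => 1)
    rw [FormalMultilinearSeries.coeff]
    refine h.trans ?_
    rw [saddlePhase_zero hk β hv0, hβ]
    field_simp
  · rw [← deriv_saddlePhase hk hv hv0, ← hβ, hp.deriv]
    rfl
  · have hx := tendsto_rpow_div_natCast (k := k) hβpos
    refine ((tendsto_pk_scaled hk hβ hA hv hv0 hev hp).comp hx).congr' ?_
    filter_upwards [hx.eventually hev, hx.eventually self_mem_nhdsWithin,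
      eventually_gt_atTop 0] with n hn hx0 hn0
    have hn0 : (0 : ℝ) < n := by exact_mod_cast hn0
    have hq : 0 < β / (n : ℝ) := div_pos hβpos hn0
    dsimp only [Function.comp_apply]
    have hpow : ((β / (n : ℝ)) ^ (1 / ((k : ℝ) + 1))) ^ (k + 1) = β / n := by
      rw [← Real.rpow_natCast, ← Real.rpow_mul hq.le]
      push_cast
      rw [one_div_mul_cancel (by positivity), Real.rpow_one]
    have hfreq : β / ((β / (n : ℝ)) ^ (1 / ((k : ℝ) + 1))) ^ (k + 1) = n := by
      rw [hpow]
      field_simp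
    have hδx : ((β / (n : ℝ)) ^ (1 / ((k : ℝ) + 1))) ^ ((k : ℝ) / (k + 1)) *
        √((β / (n : ℝ)) ^ (1 / ((k : ℝ) + 1))) ^ (k + 2) = (β / (n : ℝ)) ^ δ := by
      rw [Real.sqrt_eq_rpow, ← Real.rpow_natCast, ← Real.rpow_mul hq.le, ← Real.rpow_mul hq.le,
        ← Real.rpow_mul hq.le, ← Real.rpow_add hq, hδ]
      congr 1
      push_cast
      field_simp
      ring
    have hsum : ∑ h ∈ Finset.range (k + 1),
        p.coeff h / ((β / (n : ℝ)) ^ (1 / ((k : ℝ) + 1))) ^ (k - h) =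
        ∑ h ∈ Finset.range (k + 1),
          p.coeff h * ((n : ℝ) / β) ^ (((k : ℝ) - (h : ℝ)) / ((k : ℝ) + 1)) := by
      refine Finset.sum_congr rfl fun h hh => ?_
      have hle : h ≤ k := Nat.lt_succ_iff.1 (Finset.mem_range.1 hh)
      rw [div_eq_mul_inv, ← Real.rpow_natCast, ← Real.rpow_mul hq.le, Nat.cast_sub hle,
        ← Real.inv_rpow hq.le, inv_div, one_div_mul_eq_div]
    rw [hfreq] at hn
    rw [pk_eq_exp_mul_norm hk (mul_pos hx0 hn.1) hn.2, hδx, hsum, hfreq]
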